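/- Let Ω ⊂ ℝ^d be a bounded domain with boundary of class C^{2,γ}, let f ∈ C²(cl(Ω)×ℝ×ℝ^d, ℝ), and let T > 0. Let u₁ and u₂ be two classical solutions on the time interval [0,T] of ∂_t u = Δu + f(x, u, ∇u) with homogeneous Dirichlet boundary condition, each continuous on cl(Ω)×[0,T], C¹ in t and C² in x on Ω×(0,T], with u_i and ∇u_i bounded on Ω×[0,T]. If u₁(·,T) = u₂(·,T) on Ω, then u₁(·,t) = u₂(·,t) for every t ∈ [0,T]; that is, the flow generated by the equation has the backward uniqueness property. -/

import Mathlib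

open Set MeasureTheory

/-- The partial derivative of `f` in the `i`-th coordinate direction. -/
noncomputable def pd {d : ℕ} (i : Fin d) (f : (Fin d → ℝ) → ℝ) (x : Fin d → ℝ) : ℝ :=
  fderiv ℝ f x (Pi.single i 1)

/-- The Laplacian of `f`. -/
noncomputable def lap {d : ℕ} (f : (Fin d → ℝ) → ℝ) (x : Fin d → ℝ) : ℝ :=
  ∑ i, pd i (pd i f) x

/-- `Ω` is a domain with boundary of class `C^{2,γ}`: it admits a global defining
function `φ` of class `C²` whose second derivative is `γ`-Hölder continuous, with
nonvanishing gradient on the boundary. -/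
def HasC2HolderBoundary {d : ℕ} (Ω : Set (Fin d → ℝ)) (γ : NNReal) : Prop :=
  ∃ (φ : (Fin d → ℝ) → ℝ) (C : NNReal),
    ContDiff ℝ 2 φ ∧ HolderWith C γ (iteratedFDeriv ℝ 2 φ) ∧
    Ω = {x | φ x < 0} ∧ ∀ x ∈ frontier Ω, fderiv ℝ φ x ≠ 0

/-- `u` is a classical solution on `Ω × [0,T]` of the scalar parabolic equation with
nonlinearity `f`, with homogeneous Dirichlet boundary conditions, and `u`, `∇u`
bounded. -/
def IsClassicalSolOn {d : ℕ} (Ω : Set (Fin d → ℝ))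
    (f : ((Fin d → ℝ) × ℝ × (Fin d → ℝ)) → ℝ) (T : ℝ)
    (u : (Fin d → ℝ) → ℝ → ℝ) : Prop :=
  ContinuousOn (fun q : (Fin d → ℝ) × ℝ => u q.1 q.2) (closure Ω ×ˢ Set.Icc 0 T) ∧
  (∀ t ∈ Set.Ioc 0 T, ContDiffOn ℝ 2 (fun x => u x t) Ω) ∧
  (∀ x ∈ Ω, ContDiffOn ℝ 1 (u x) (Set.Ioc 0 T)) ∧
  (∀ x ∈ frontier Ω, ∀ t ∈ Set.Icc (0:ℝ) T, u x t = 0) ∧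
  (∀ x ∈ Ω, ∀ t ∈ Set.Ioc (0:ℝ) T,
    derivWithin (u x) (Set.Ioc 0 T) t
      = lap (fun y => u y t) x + f (x, u x t, fun i => pd i (fun y => u y t) x)) ∧
  (∃ R : ℝ, ∀ x ∈ Ω, ∀ t ∈ Set.Icc (0:ℝ) T,
    |u x t| ≤ R ∧ ∀ i, |pd i (fun y => u y t) x| ≤ R)

section BUHelpers

open Filter Topology

/-- One-dimensional second derivative test (necessary condition). -/
lemma bu_second_deriv_nonpos {k k' : ℝ → ℝ} {k2 r : ℝ}
    (hk : ∀ᶠ s in 𝓝 r, HasDerivAt k (k' s) s) (hk' : HasDerivAt k' k2 r)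
    (hmax : IsLocalMax k r) : k2 ≤ 0 := by
  by_contra hpos
  push Not at hpos
  have hd : deriv k =ᶠ[𝓝 r] k' := hk.mono fun s hs => hs.deriv
  have h2 : deriv (deriv k) r = k2 := by rw [hd.deriv_eq]; exact hk'.deriv
  have h1 : deriv k r = 0 := hmax.deriv_eq_zero
  have hmin : IsLocalMin k r :=
    isLocalMin_of_deriv_deriv_pos (by rw [h2]; exact hpos) h1 hk.self_of_nhds.continuousAt
  have hconst : k =ᶠ[𝓝 r] fun _ => k r := by
    filter_upwards [hmax, hmin] with s h1 h2 using le_antisymm h1 h2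
  have h3 : deriv k =ᶠ[𝓝 r] fun _ => 0 := by
    have := hconst.deriv
    simpa using this
  have : deriv (deriv k) r = 0 := by rw [h3.deriv_eq]; simp
  linarith

lemma bu_line_deriv {d : ℕ} {q : (Fin d → ℝ) → ℝ} {x : Fin d → ℝ} {i : Fin d} {s : ℝ}
    (h : DifferentiableAt ℝ q (x + s • Pi.single i (1:ℝ))) :
    HasDerivAt (fun s : ℝ => q (x + s • Pi.single i (1:ℝ)))
      (pd i q (x + s • Pi.single i (1:ℝ))) s := by
  have h1 : HasDerivAt (fun s : ℝ => x + s • (Pi.single i (1:ℝ) : Fin d → ℝ))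
      (Pi.single i (1:ℝ)) s := by
    simpa using ((hasDerivAt_id s).smul_const (Pi.single i (1:ℝ) : Fin d → ℝ)).const_add x
  exact h.hasFDerivAt.comp_hasDerivAt s h1

lemma bu_pd_contDiffAt {d : ℕ} {q : (Fin d → ℝ) → ℝ} {x : Fin d → ℝ} (i : Fin d)
    (h : ContDiffAt ℝ 2 q x) : ContDiffAt ℝ 1 (pd i q) x := by
  have h1 : ContDiffAt ℝ 1 (fderiv ℝ q) x := h.fderiv_right (by norm_num)
  exact h1.clm_apply contDiffAt_const

lemma bu_pd_diff {d : ℕ} {q : (Fin d → ℝ) → ℝ} {x : Fin d → ℝ} (i : Fin d)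
    (h : ContDiffAt ℝ 2 q x) : DifferentiableAt ℝ (pd i q) x :=
  (bu_pd_contDiffAt i h).differentiableAt (by norm_num)

lemma bu_eventually_c2 {d : ℕ} {q : (Fin d → ℝ) → ℝ} {x : Fin d → ℝ}
    (h : ContDiffAt ℝ 2 q x) : ∀ᶠ y in 𝓝 x, ContDiffAt ℝ 2 q y :=
  h.eventually (by simp)

lemma bu_line_deriv_ev {d : ℕ} {q : (Fin d → ℝ) → ℝ} {x : Fin d → ℝ} {i : Fin d} {r : ℝ}
    (h : ContDiffAt ℝ 2 q (x + r • Pi.single i (1:ℝ))) :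
    ∀ᶠ s in 𝓝 r, HasDerivAt (fun s : ℝ => q (x + s • Pi.single i (1:ℝ)))
      (pd i q (x + s • Pi.single i (1:ℝ))) s := by
  have hc : ContinuousAt (fun s : ℝ => x + s • (Pi.single i (1:ℝ) : Fin d → ℝ)) r := by fun_prop
  filter_upwards [hc.eventually (bu_eventually_c2 h)] with s hs
  exact bu_line_deriv (hs.differentiableAt (by norm_num))

lemma bu_pd_add {d : ℕ} {p q : (Fin d → ℝ) → ℝ} {x : Fin d → ℝ} (i : Fin d)
    (hp : DifferentiableAt ℝ p x) (hq : DifferentiableAt ℝ q x) :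
    pd i (fun y => p y + q y) x = pd i p x + pd i q x := by
  unfold pd; rw [fderiv_fun_add hp hq]; simp

lemma bu_pd_sub {d : ℕ} {p q : (Fin d → ℝ) → ℝ} {x : Fin d → ℝ} (i : Fin d)
    (hp : DifferentiableAt ℝ p x) (hq : DifferentiableAt ℝ q x) :
    pd i (fun y => p y - q y) x = pd i p x - pd i q x := by
  unfold pd; rw [fderiv_fun_sub hp hq]; simp

lemma bu_pd_neg {d : ℕ} {p : (Fin d → ℝ) → ℝ} {x : Fin d → ℝ} (i : Fin d) :
    pd i (fun y => - p y) x = - pd i p x := by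
  unfold pd; rw [fderiv_fun_neg]; simp

lemma bu_lap_neg {d : ℕ} {p : (Fin d → ℝ) → ℝ} {x : Fin d → ℝ} :
    lap (fun y => - p y) x = - lap p x := by
  unfold lap
  rw [← Finset.sum_neg_distrib]
  refine Finset.sum_congr rfl fun i _ => ?_
  have : pd i (fun y => - p y) = fun y => - pd i p y := by ext y; exact bu_pd_neg i
  rw [this]; exact bu_pd_neg i

lemma bu_pd2_sub {d : ℕ} {p q : (Fin d → ℝ) → ℝ} {x : Fin d → ℝ} (i : Fin d)
    (hp : ContDiffAt ℝ 2 p x) (hq : ContDiffAt ℝ 2 q x) :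
    pd i (pd i (fun y => p y - q y)) x = pd i (pd i p) x - pd i (pd i q) x := by
  have h : pd i (fun y => p y - q y) =ᶠ[𝓝 x] fun y => pd i p y - pd i q y := by
    filter_upwards [bu_eventually_c2 hp, bu_eventually_c2 hq] with y h1 h2
    exact bu_pd_sub i (h1.differentiableAt (by norm_num)) (h2.differentiableAt (by norm_num))
  have : pd i (pd i (fun y => p y - q y)) x = pd i (fun y => pd i p y - pd i q y) x := by
    unfold pd at h ⊢; rw [h.fderiv_eq]
  rw [this]
  exact bu_pd_sub i (bu_pd_diff i hp) (bu_pd_diff i hq)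

lemma bu_lap_sub {d : ℕ} {p q : (Fin d → ℝ) → ℝ} {x : Fin d → ℝ}
    (hp : ContDiffAt ℝ 2 p x) (hq : ContDiffAt ℝ 2 q x) :
    lap (fun y => p y - q y) x = lap p x - lap q x := by
  unfold lap
  rw [← Finset.sum_sub_distrib]
  exact Finset.sum_congr rfl fun i _ => bu_pd2_sub i hp hq

lemma bu_pd_shift {d : ℕ} {p : (Fin d → ℝ) → ℝ} {x c : Fin d → ℝ} (i : Fin d) :
    pd i (fun y => p (y + c)) x = pd i p (x + c) := by
  unfold pd; rw [fderiv_comp_add_right]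

lemma bu_lap_shift {d : ℕ} {p : (Fin d → ℝ) → ℝ} {x c : Fin d → ℝ} :
    lap (fun y => p (y + c)) x = lap p (x + c) := by
  unfold lap
  refine Finset.sum_congr rfl fun i _ => ?_
  have : pd i (fun y => p (y + c)) = fun y => pd i p (y + c) := by ext y; exact bu_pd_shift i
  rw [this]; exact bu_pd_shift i

/-- Second derivative along a line minus a quadratic penalty at a local maximum. -/
lemma bu_pd2_le {d : ℕ} {q : (Fin d → ℝ) → ℝ} {x x0 : Fin d → ℝ} {κ : ℝ} (i : Fin d)
    (hq : ContDiffAt ℝ 2 q x)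
    (hmax : IsLocalMax (fun y => q y - κ * ∑ j, (y j - x0 j) ^ 2) x) :
    pd i (pd i q) x ≤ 2 * κ := by
  set e : Fin d → ℝ := Pi.single i (1:ℝ) with he
  have hx : x + (0:ℝ) • e = x := by simp
  have hc : ContinuousAt (fun s : ℝ => x + s • e) 0 := by fun_prop
  have hm : IsLocalMax (fun s : ℝ => q (x + s • e) - κ * ∑ j, ((x + s • e) j - x0 j) ^ 2) 0 := by
    have h1 : ∀ᶠ y in 𝓝 (x + (0:ℝ) • e), (q y - κ * ∑ j, (y j - x0 j) ^ 2) ≤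
        (q x - κ * ∑ j, (x j - x0 j) ^ 2) := by rw [hx]; exact hmax
    have := hc.eventually h1
    filter_upwards [this] with s hs
    simpa using hs
  have hp : ∀ s : ℝ, HasDerivAt (fun s : ℝ => κ * ∑ j, ((x + s • e) j - x0 j) ^ 2)
      (κ * ∑ j, 2 * ((x + s • e) j - x0 j) * e j) s := by
    intro s
    refine HasDerivAt.const_mul κ (HasDerivAt.fun_sum fun j _ => ?_)
    have : HasDerivAt (fun s : ℝ => (x + s • e) j - x0 j) (e j) s := by
      simpa using (((hasDerivAt_id s).mul_const (e j)).const_add (x j)).sub_const (x0 j)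
    simpa using this.fun_pow 2
  have hp2 : HasDerivAt (fun s : ℝ => κ * ∑ j, 2 * ((x + s • e) j - x0 j) * e j)
      (κ * ∑ j, 2 * e j * e j) 0 := by
    refine HasDerivAt.const_mul κ (HasDerivAt.fun_sum fun j _ => ?_)
    have : HasDerivAt (fun s : ℝ => (x + s • e) j - x0 j) (e j) 0 := by
      simpa using (((hasDerivAt_id (0:ℝ)).mul_const (e j)).const_add (x j)).sub_const (x0 j)
    exact (this.const_mul 2).mul_const (e j)
  have hsum : ∑ j, 2 * e j * e j = 2 := by
    rw [Finset.sum_eq_single i]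
    · simp [he]
    · intro j _ hj; simp [he, hj]
    · simp
  rw [hsum] at hp2
  have hq' : ContDiffAt ℝ 2 q (x + (0:ℝ) • e) := by rw [hx]; exact hq
  have hq2 := bu_line_deriv (s := 0) (x := x) (i := i) (q := pd i q) (bu_pd_diff i hq')
  have := bu_second_deriv_nonpos
    ((bu_line_deriv_ev hq').mono fun s hs => hs.sub (hp s)) (hq2.sub hp2) hm
  rw [← he, hx] at this
  linarith

lemma bu_norm_sq_le_sum {d : ℕ} (y : Fin d → ℝ) : ‖y‖ ^ 2 ≤ ∑ j, y j ^ 2 := by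
  have h0 : 0 ≤ ∑ j, y j ^ 2 := Finset.sum_nonneg fun j _ => sq_nonneg _
  have : ‖y‖ ≤ √(∑ j, y j ^ 2) := by
    rw [pi_norm_le_iff_of_nonneg (Real.sqrt_nonneg _)]
    intro j
    apply Real.le_sqrt_of_sq_le
    rw [Real.norm_eq_abs, sq_abs]
    exact Finset.single_le_sum (f := fun j => y j ^ 2) (fun j _ => sq_nonneg _) (Finset.mem_univ j)
  calc ‖y‖ ^ 2 ≤ (√(∑ j, y j ^ 2)) ^ 2 := by gcongr
    _ = _ := Real.sq_sqrt h0

set_option maxHeartbeats 2000000 in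
/-- Interior gradient estimate, by doubling of variables. -/
lemma bu_grad_est {d : ℕ} (V : (Fin d → ℝ) → ℝ → ℝ) (x0 : Fin d → ℝ) (t0 ρ M b : ℝ)
    (hρ : 0 < ρ) (hM : 0 < M) (hb : 0 ≤ b)
    (hcont : ContinuousOn (fun q : (Fin d → ℝ) × ℝ => V q.1 q.2)
      (Metric.closedBall x0 (2 * ρ) ×ˢ Icc (t0 - ρ) (t0 + ρ)))
    (hC2 : ∀ x ∈ Metric.closedBall x0 (2 * ρ), ∀ t ∈ Icc (t0 - ρ) (t0 + ρ),
      ContDiffAt ℝ 2 (fun y => V y t) x)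
    (hpde : ∀ x ∈ Metric.closedBall x0 (2 * ρ), ∀ t ∈ Icc (t0 - ρ) (t0 + ρ),
      ∃ B, |B| ≤ b ∧ HasDerivAt (V x) (lap (fun y => V y t) x + B) t)
    (hbd : ∀ x ∈ Metric.closedBall x0 (2 * ρ), ∀ t ∈ Icc (t0 - ρ) (t0 + ρ), |V x t| ≤ M)
    (i : Fin d) :
    pd i (fun y => V y t0) x0 ≤ √(2 * M * (b + 1 + 2 * M / ρ ^ 2 * (d + ρ + 1))) := by
  set κ := 2 * M / ρ ^ 2 with hκ
  set N := b + 1 + κ * (d + ρ + 1) with hN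
  have hκ0 : 0 < κ := by positivity
  have hd0 : (0:ℝ) ≤ d := Nat.cast_nonneg d
  have hNκ : κ ≤ N := by nlinarith [mul_nonneg hκ0.le hd0, mul_pos hκ0 hρ]
  have hN0 : 0 < N := lt_of_lt_of_le hκ0 hNκ
  have hκρ : κ * ρ ^ 2 = 2 * M := by rw [hκ]; field_simp
  set r0 := √(2 * M / N) with hr0
  have hr0pos : 0 < r0 := Real.sqrt_pos.2 (by positivity)
  have hr0sq : N * r0 ^ 2 = 2 * M := by
    rw [hr0, Real.sq_sqrt (by positivity)]; field_simp
  have hr0ρ : r0 ≤ ρ := by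
    have : r0 ^ 2 ≤ ρ ^ 2 := by nlinarith [mul_le_mul_of_nonneg_right hNκ (sq_nonneg ρ)]
    exact (pow_le_pow_iff_left₀ hr0pos.le hρ.le two_ne_zero).1 this
  have hNr0 : N * r0 = √(2 * M * N) := by
    symm
    rw [Real.sqrt_eq_iff_mul_self_eq (by positivity) (by positivity)]
    nlinarith
  rw [← hNr0]
  set e : Fin d → ℝ := Pi.single i (1:ℝ) with he
  have hnorme : ‖e‖ = 1 := by rw [he, Pi.norm_single]; simp
  -- evaluation points stay in the big ball
  have hin : ∀ x ∈ Metric.closedBall x0 ρ, ∀ r : ℝ, |r| ≤ r0 →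
      x + r • e ∈ Metric.closedBall x0 (2 * ρ) := by
    intro x hx r hr
    rw [mem_closedBall_iff_norm] at hx ⊢
    calc ‖x + r • e - x0‖ = ‖(x - x0) + r • e‖ := by congr 1; abel
      _ ≤ ‖x - x0‖ + ‖r • e‖ := norm_add_le _ _
      _ = ‖x - x0‖ + |r| := by rw [norm_smul, hnorme]; simp
      _ ≤ 2 * ρ := by linarith
  set Φ : (Fin d → ℝ) × ℝ × ℝ → ℝ := fun p =>
    V (p.1 + p.2.2 • e) p.2.1 - V (p.1 + (-p.2.2) • e) p.2.1
      - (2 * N * r0 * p.2.2 - N * p.2.2 ^ 2)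
      - κ * (∑ j, (p.1 j - x0 j) ^ 2) - κ * (p.2.1 - t0) ^ 2 with hΦ
  set C : Set ((Fin d → ℝ) × ℝ × ℝ) :=
    Metric.closedBall x0 ρ ×ˢ Icc (t0 - ρ) (t0 + ρ) ×ˢ Icc 0 r0 with hC
  have hCc : IsCompact C := (isCompact_closedBall x0 ρ).prod (isCompact_Icc.prod isCompact_Icc)
  have hΦc : ContinuousOn Φ C := by
    have h1 : ContinuousOn (fun p : (Fin d → ℝ) × ℝ × ℝ => V (p.1 + p.2.2 • e) p.2.1) C := by
      refine hcont.comp (f := fun p : (Fin d → ℝ) × ℝ × ℝ => (p.1 + p.2.2 • e, p.2.1))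
        (by fun_prop) ?_
      rintro ⟨x, t, r⟩ ⟨hx, ht, hr⟩
      exact ⟨hin x hx r (by rw [abs_of_nonneg hr.1]; exact hr.2), ht⟩
    have h2 : ContinuousOn (fun p : (Fin d → ℝ) × ℝ × ℝ => V (p.1 + (-p.2.2) • e) p.2.1) C := by
      refine hcont.comp (f := fun p : (Fin d → ℝ) × ℝ × ℝ => (p.1 + (-p.2.2) • e, p.2.1))
        (by fun_prop) ?_
      rintro ⟨x, t, r⟩ ⟨hx, ht, hr⟩
      exact ⟨hin x hx (-r) (by rw [abs_neg, abs_of_nonneg hr.1]; exact hr.2), ht⟩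
    exact (((h1.sub h2).sub (by fun_prop)).sub (by fun_prop)).sub (by fun_prop)
  -- the key claim
  have key : ∀ r ∈ Icc 0 r0, Φ (x0, t0, r) ≤ 0 := by
    by_contra hcon
    push Not at hcon
    obtain ⟨r1, hr1, hpos⟩ := hcon
    have hmem : ((x0, t0, r1) : (Fin d → ℝ) × ℝ × ℝ) ∈ C :=
      ⟨Metric.mem_closedBall_self hρ.le, ⟨by linarith, by linarith⟩, hr1⟩
    obtain ⟨⟨x, t, r⟩, ⟨hx, ht, hr⟩, hmax⟩ := hCc.exists_isMaxOn ⟨_, hmem⟩ hΦc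
    have hΦpos : 0 < Φ (x, t, r) := lt_of_lt_of_le hpos (hmax hmem)
    simp only at hx ht hr
    have hrabs : |r| ≤ r0 := by rw [abs_of_nonneg hr.1]; exact hr.2
    have hp := hin x hx r hrabs
    have hm := hin x hx (-r) (by rwa [abs_neg])
    have hVp := abs_le.1 (hbd _ hp t ht)
    have hVm := abs_le.1 (hbd _ hm t ht)
    have hsum0 : 0 ≤ ∑ j, (x j - x0 j) ^ 2 := Finset.sum_nonneg fun j _ => sq_nonneg _
    have hω : 0 ≤ 2 * N * r0 * r - N * r ^ 2 := by
      have : 0 ≤ N * r * (2 * r0 - r) :=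
        mul_nonneg (mul_nonneg hN0.le hr.1) (by linarith [hr.2])
      nlinarith
    have hΦv : Φ (x, t, r) = V (x + r • e) t - V (x + (-r) • e) t
      - (2 * N * r0 * r - N * r ^ 2) - κ * (∑ j, (x j - x0 j) ^ 2) - κ * (t - t0) ^ 2 := rfl
    have hks := mul_nonneg hκ0.le hsum0
    have hkt := mul_nonneg hκ0.le (sq_nonneg (t - t0))
    have hrpos : 0 < r := by
      rcases hr.1.lt_or_eq with h | h
      · exact h
      · exfalso
        rw [← h] at hΦv hΦpos
        simp at hΦv
        linarith
    have hrlt : r < r0 := by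
      rcases hr.2.lt_or_eq with h | h
      · exact h
      · exfalso
        have : 2 * N * r0 * r - N * r ^ 2 = 2 * M := by rw [h]; linarith
        linarith
    have htne : |t - t0| < ρ := by
      by_contra h
      push Not at h
      have : ρ ^ 2 ≤ (t - t0) ^ 2 := by rw [← sq_abs (t - t0)]; gcongr
      have := mul_le_mul_of_nonneg_left this hκ0.le
      linarith
    have htio : t ∈ Ioo (t0 - ρ) (t0 + ρ) := by
      rw [abs_lt] at htne; exact ⟨by linarith, by linarith⟩
    have hxb : x ∈ Metric.ball x0 ρ := by
      rw [mem_ball_iff_norm]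
      by_contra h
      push Not at h
      have h1 : ρ ^ 2 ≤ ‖x - x0‖ ^ 2 := by gcongr
      have h2 := bu_norm_sq_le_sum (x - x0)
      simp only [Pi.sub_apply] at h2
      have := mul_le_mul_of_nonneg_left (h1.trans h2) hκ0.le
      linarith
    -- second derivatives in x
    have hcp : ContDiffAt ℝ 2 (fun y => V (y + r • e) t) x :=
      (hC2 _ hp t ht).comp x (f := fun y => y + r • e) (by fun_prop)
    have hcm : ContDiffAt ℝ 2 (fun y => V (y + (-r) • e) t) x :=
      (hC2 _ hm t ht).comp x (f := fun y => y + (-r) • e) (by fun_prop)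
    have hxmax : IsLocalMax (fun y => (V (y + r • e) t - V (y + (-r) • e) t)
        - κ * ∑ j, (y j - x0 j) ^ 2) x := by
      filter_upwards [Metric.isOpen_ball.mem_nhds hxb] with y hy
      have : Φ (y, t, r) ≤ Φ (x, t, r) := hmax ⟨Metric.ball_subset_closedBall hy, ht, hr⟩
      simp only [hΦ] at this
      linarith
    have hj : ∀ j, pd j (pd j (fun y => V y t)) (x + r • e)
        - pd j (pd j (fun y => V y t)) (x + (-r) • e) ≤ 2 * κ := by
      intro j
      have h1 := bu_pd2_le j (hcp.sub hcm) hxmax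
      rw [bu_pd2_sub j hcp hcm] at h1
      have sh : ∀ c, pd j (pd j (fun y => V (y + c) t)) x
          = pd j (pd j (fun y => V y t)) (x + c) := by
        intro c
        have : pd j (fun y => V (y + c) t) = fun y => pd j (fun y => V y t) (y + c) := by
          ext y; exact bu_pd_shift (p := fun y => V y t) j
        rw [this]; exact bu_pd_shift j
      rwa [sh, sh] at h1
    have hi : pd i (pd i (fun y => V y t)) (x + r • e)
        - pd i (pd i (fun y => V y t)) (x + (-r) • e) ≤ - (2 * N) := by
      have hmaxr : IsLocalMax (fun s : ℝ => (V (x + s • e) t - V (x + (-s) • e) t)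
          - (2 * N * r0 * s - N * s ^ 2)) r := by
        filter_upwards [isOpen_Ioo.mem_nhds (show r ∈ Ioo 0 r0 from ⟨hrpos, hrlt⟩)] with s hs
        have : Φ (x, t, s) ≤ Φ (x, t, r) := hmax ⟨hx, ht, ⟨hs.1.le, hs.2.le⟩⟩
        simp only [hΦ] at this
        linarith
      have d1 := bu_line_deriv_ev (hC2 _ hp t ht)
      have d2 : ∀ᶠ s in 𝓝 r, HasDerivAt (fun s : ℝ => V (x + (-s) • e) t)
          (- pd i (fun y => V y t) (x + (-s) • e)) s := by
        have h0 := bu_line_deriv_ev (hC2 _ hm t ht)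
        have hneg : Tendsto (fun s : ℝ => -s) (𝓝 r) (𝓝 (-r)) := continuous_neg.continuousAt
        filter_upwards [hneg.eventually h0] with s hs
        have := hs.scomp s (hasDerivAt_neg s)
        simpa [Function.comp_def] using this
      have d3 : ∀ s : ℝ, HasDerivAt (fun s : ℝ => 2 * N * r0 * s - N * s ^ 2)
          (2 * N * r0 - 2 * N * s) s := by
        intro s
        have := ((hasDerivAt_id' s).const_mul (2 * N * r0)).fun_sub
          (((hasDerivAt_id' s).fun_pow 2).const_mul N)
        refine this.congr_deriv ?_
        norm_num; ring
      have d4 : HasDerivAt (fun s : ℝ => 2 * N * r0 - 2 * N * s) (- (2 * N)) r := by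
        have := ((hasDerivAt_id r).const_mul (2 * N)).const_sub (2 * N * r0)
        simpa using this
      have e1 := bu_line_deriv (bu_pd_diff i (hC2 _ hp t ht))
      have e2 : HasDerivAt (fun s : ℝ => - pd i (fun y => V y t) (x + (-s) • e))
          (pd i (pd i (fun y => V y t)) (x + (-r) • e)) r := by
        have := ((bu_line_deriv (bu_pd_diff i (hC2 _ hm t ht))).scomp r (hasDerivAt_neg r)).fun_neg
        refine this.congr_deriv ?_
        rw [neg_smul, one_smul, neg_neg]
      have := bu_second_deriv_nonpos (r := r)
        (k := fun s : ℝ => (V (x + s • e) t - V (x + (-s) • e) t) - (2 * N * r0 * s - N * s ^ 2))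
        (k' := fun s => (pd i (fun y => V y t) (x + s • e) -
          - pd i (fun y => V y t) (x + (-s) • e)) - (2 * N * r0 - 2 * N * s))
        (by filter_upwards [d1, d2] with s h1 h2 using (h1.sub h2).sub (d3 s))
        (by
          have h := (e1.sub (f := fun s : ℝ => pd i (fun y => V y t) (x + s • e)) e2).sub d4
          exact h) hmaxr
      rw [← he] at this
      linarith
    have hlap : lap (fun y => V y t) (x + r • e) - lap (fun y => V y t) (x + (-r) • e)
        ≤ 2 * κ * d - 2 * N := by
      unfold lap
      rw [← Finset.sum_sub_distrib, ← Finset.add_sum_erase _ _ (Finset.mem_univ i)]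
      have h1 : ∑ j ∈ Finset.univ.erase i, (pd j (pd j (fun y => V y t)) (x + r • e)
          - pd j (pd j (fun y => V y t)) (x + (-r) • e)) ≤ 2 * κ * d := by
        calc _ ≤ ∑ j ∈ Finset.univ.erase i, 2 * κ := Finset.sum_le_sum fun j _ => hj j
          _ ≤ ∑ j : Fin d, 2 * κ :=
            Finset.sum_le_sum_of_subset_of_nonneg (Finset.erase_subset _ _)
              fun _ _ _ => by positivity
          _ = 2 * κ * d := by simp; ring
      linarith
    -- time derivative
    obtain ⟨B1, hB1, hd1⟩ := hpde _ hp t ht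
    obtain ⟨B2, hB2, hd2⟩ := hpde _ hm t ht
    have htmax : IsLocalMax (fun s => (V (x + r • e) s - V (x + (-r) • e) s)
        - κ * (s - t0) ^ 2) t := by
      filter_upwards [isOpen_Ioo.mem_nhds htio] with s hs
      have : Φ (x, s, r) ≤ Φ (x, t, r) := hmax ⟨hx, ⟨hs.1.le, hs.2.le⟩, hr⟩
      simp only [hΦ] at this
      linarith
    have hdt : HasDerivAt (fun s => κ * (s - t0) ^ 2) (κ * (2 * (t - t0))) t := by
      have := (((hasDerivAt_id' t).sub_const t0).fun_pow 2).const_mul κ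
      refine this.congr_deriv ?_
      norm_num
    have hz := htmax.hasDerivAt_eq_zero ((hd1.sub hd2).sub hdt)
    have hB1' := abs_le.1 hB1
    have hB2' := abs_le.1 hB2
    have ht' := abs_lt.1 htne
    have : κ * (2 * (t - t0)) ≥ - (2 * κ * ρ) := by nlinarith
    nlinarith
  -- conclude
  have hx0 : x0 ∈ Metric.closedBall x0 (2 * ρ) := Metric.mem_closedBall_self (by linarith)
  have ht0 : t0 ∈ Icc (t0 - ρ) (t0 + ρ) := ⟨by linarith, by linarith⟩
  have hdiff : DifferentiableAt ℝ (fun y => V y t0) (x0 + (0:ℝ) • e) := by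
    simpa using (hC2 _ hx0 _ ht0).differentiableAt (by norm_num)
  have dd1 := bu_line_deriv hdiff
  have dd2 : HasDerivAt (fun s : ℝ => V (x0 + (-s) • e) t0) (- pd i (fun y => V y t0) x0) 0 := by
    have hdiff' : DifferentiableAt ℝ (fun y => V y t0) (x0 + (-0:ℝ) • e) := by simpa using hdiff
    have := (bu_line_deriv hdiff').scomp (0:ℝ) (hasDerivAt_neg (0:ℝ))
    simpa [Function.comp_def] using this
  have dd : HasDerivAt (fun s : ℝ => V (x0 + s • e) t0 - V (x0 + (-s) • e) t0)
      (2 * pd i (fun y => V y t0) x0) 0 := by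
    have h := dd1.fun_sub dd2
    refine h.congr_deriv ?_
    rw [← he, zero_smul, add_zero]; ring
  have hlim := dd.tendsto_slope_zero_right
  have hle : 2 * pd i (fun y => V y t0) x0 ≤ 2 * N * r0 := by
    refine le_of_tendsto hlim ?_
    filter_upwards [Ioo_mem_nhdsGT hr0pos] with s hs
    have := key s ⟨hs.1.le, hs.2.le⟩
    simp only [hΦ] at this
    simp only [zero_add, zero_smul, add_zero, neg_zero, sub_self, smul_eq_mul, sub_zero]
    rw [inv_mul_le_iff₀ hs.1]
    simp at this
    have h2 : 0 ≤ N * s ^ 2 := by positivity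
    simp only [neg_smul]
    linarith
  linarith

/-- Pointwise interior solution of `w_t = Δ w + g`. -/
structure BUSol {d : ℕ} (Ω : Set (Fin d → ℝ)) (T : ℝ) (w g : (Fin d → ℝ) → ℝ → ℝ) : Prop where
  cont : ContinuousOn (fun q : (Fin d → ℝ) × ℝ => w q.1 q.2) (Ω ×ˢ Ioo 0 T)
  c2 : ∀ t ∈ Ioo 0 T, ∀ x ∈ Ω, ContDiffAt ℝ 2 (fun y => w y t) x
  pde : ∀ x ∈ Ω, ∀ t ∈ Ioo 0 T, HasDerivAt (w x) (lap (fun y => w y t) x + g x t) t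

lemma BUSol.neg {d : ℕ} {Ω : Set (Fin d → ℝ)} {T : ℝ} {w g : (Fin d → ℝ) → ℝ → ℝ}
    (h : BUSol Ω T w g) : BUSol Ω T (fun x t => - w x t) (fun x t => - g x t) where
  cont := h.cont.neg
  c2 := fun t ht x hx => (h.c2 t ht x hx).neg
  pde := fun x hx t ht => by
    have := (h.pde x hx t ht).fun_neg
    rw [bu_lap_neg]
    refine this.congr_deriv ?_
    ring

lemma BUSol.sub {d : ℕ} {Ω : Set (Fin d → ℝ)} {T : ℝ} {w g w' g' : (Fin d → ℝ) → ℝ → ℝ}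
    (h : BUSol Ω T w g) (h' : BUSol Ω T w' g') :
    BUSol Ω T (fun x t => w x t - w' x t) (fun x t => g x t - g' x t) where
  cont := h.cont.sub h'.cont
  c2 := fun t ht x hx => (h.c2 t ht x hx).sub (h'.c2 t ht x hx)
  pde := fun x hx t ht => by
    have := (h.pde x hx t ht).fun_sub (h'.pde x hx t ht)
    rw [bu_lap_sub (h.c2 t ht x hx) (h'.c2 t ht x hx)]
    refine this.congr_deriv ?_
    ring

lemma BUSol.pd_cont {d : ℕ} {Ω : Set (Fin d → ℝ)} {T : ℝ} {w g : (Fin d → ℝ) → ℝ → ℝ}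
    (h : BUSol Ω T w g) (hΩ : IsOpen Ω) {b : ℝ} (hb : 0 ≤ b)
    (hg : ∀ x ∈ Ω, ∀ t ∈ Ioo 0 T, |g x t| ≤ b) (i : Fin d) :
    ContinuousOn (fun q : (Fin d → ℝ) × ℝ => pd i (fun y => w y q.2) q.1) (Ω ×ˢ Ioo 0 T) := by
  rintro ⟨x0, t0⟩ ⟨hx0, ht0⟩
  apply ContinuousAt.continuousWithinAt
  simp only at hx0 ht0
  -- a small box
  obtain ⟨ρ, hρ, hρΩ, hρT⟩ : ∃ ρ > 0, Metric.closedBall x0 (3 * ρ) ⊆ Ω ∧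
      Icc (t0 - 2 * ρ) (t0 + 2 * ρ) ⊆ Ioo 0 T := by
    obtain ⟨r, hr, hrs⟩ := Metric.nhds_basis_closedBall.mem_iff.1 (hΩ.mem_nhds hx0)
    have h1 := ht0.1
    have h2 := ht0.2
    refine ⟨min (r / 3) (min (t0 / 3) ((T - t0) / 3)), ?_, ?_, ?_⟩
    · have := sub_pos.2 h2
      positivity
    · refine (Metric.closedBall_subset_closedBall ?_).trans hrs
      linarith [min_le_left (r / 3) (min (t0 / 3) ((T - t0) / 3))]
    · have h3 := (min_le_right (r / 3) (min (t0 / 3) ((T - t0) / 3))).trans (min_le_left _ _)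
      have h4 := (min_le_right (r / 3) (min (t0 / 3) ((T - t0) / 3))).trans (min_le_right _ _)
      intro s hs
      exact ⟨by linarith [hs.1], by linarith [hs.2]⟩
  rw [Metric.continuousAt_iff]
  intro ε hε
  obtain ⟨M, hM, hMε⟩ : ∃ M > 0, √(2 * M * (2 * b + 1 + 2 * M / ρ ^ 2 * (d + ρ + 1))) < ε := by
    have hc : ContinuousAt (fun M : ℝ => √(2 * M * (2 * b + 1 + 2 * M / ρ ^ 2 * (d + ρ + 1)))) 0 := by
      fun_prop
    have : ∀ᶠ M in 𝓝 (0:ℝ), √(2 * M * (2 * b + 1 + 2 * M / ρ ^ 2 * (d + ρ + 1))) < ε := by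
      apply hc.eventually_lt continuousAt_const
      simpa using hε
    obtain ⟨M, hM, hM'⟩ := ((this.filter_mono (nhdsWithin_le_nhds (s := Ioi 0))).and
      self_mem_nhdsWithin).exists
    exact ⟨M, hM', hM⟩
  have hQ : IsCompact (Metric.closedBall x0 (3 * ρ) ×ˢ Icc (t0 - 2 * ρ) (t0 + 2 * ρ)) :=
    (isCompact_closedBall _ _).prod isCompact_Icc
  have huc := hQ.uniformContinuousOn_of_continuous (h.cont.mono (prod_mono hρΩ hρT))
  obtain ⟨δ, hδ, hδM⟩ := Metric.uniformContinuousOn_iff.1 huc M hM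
  refine ⟨min δ ρ, by positivity, ?_⟩
  rintro ⟨x1, t1⟩ hdist
  have hxt := lt_of_lt_of_le hdist (min_le_right δ ρ)
  have hdδ := lt_of_lt_of_le hdist (min_le_left δ ρ)
  rw [Prod.dist_eq, max_lt_iff] at hxt
  simp only at hxt
  obtain ⟨hx1, ht1⟩ := hxt
  rw [dist_eq_norm] at hx1
  rw [Real.dist_eq, abs_lt] at ht1
  set c := x1 - x0 with hc
  set τ := t1 - t0 with hτ
  have hball2 : ∀ x ∈ Metric.closedBall x0 (2 * ρ), x ∈ Metric.closedBall x0 (3 * ρ) ∧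
      x + c ∈ Metric.closedBall x0 (3 * ρ) := by
    intro x hx
    refine ⟨Metric.closedBall_subset_closedBall (by linarith) hx, ?_⟩
    rw [mem_closedBall_iff_norm] at hx ⊢
    calc ‖x + c - x0‖ = ‖(x - x0) + c‖ := by congr 1; abel
      _ ≤ ‖x - x0‖ + ‖c‖ := norm_add_le _ _
      _ ≤ 3 * ρ := by linarith
  have htime : ∀ t ∈ Icc (t0 - ρ) (t0 + ρ), t ∈ Icc (t0 - 2 * ρ) (t0 + 2 * ρ) ∧
      t + τ ∈ Icc (t0 - 2 * ρ) (t0 + 2 * ρ) := by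
    intro t ht
    exact ⟨⟨by linarith [ht.1], by linarith [ht.2]⟩, ⟨by linarith [ht.1], by linarith [ht.2]⟩⟩
  have hcore : ∀ sg : ℝ, (sg = 1 ∨ sg = -1) →
      sg * (pd i (fun y => w y t1) x1 - pd i (fun y => w y t0) x0)
        ≤ √(2 * M * (2 * b + 1 + 2 * M / ρ ^ 2 * (d + ρ + 1))) := by
    intro sg hsg
    have hsgabs : |sg| = 1 := by rcases hsg with h | h <;> simp [h]
    have hcd : ∀ x ∈ Metric.closedBall x0 (2 * ρ), ∀ t ∈ Icc (t0 - ρ) (t0 + ρ),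
        ContDiffAt ℝ 2 (fun y => w (y + c) (t + τ)) x ∧ ContDiffAt ℝ 2 (fun y => w y t) x := by
      intro x hx t ht
      refine ⟨?_, h.c2 _ (hρT (htime t ht).1) _ (hρΩ (hball2 x hx).1)⟩
      exact (h.c2 _ (hρT (htime t ht).2) _ (hρΩ (hball2 x hx).2)).comp x
        (f := fun y => y + c) (by fun_prop)
    have hm : ∀ s : ℝ, ∀ (q : (Fin d → ℝ) → ℝ), (s = 1 ∨ s = -1) →
        ∀ x, lap (fun y => s * q y) x = s * lap q x := by
      intro s q hs x
      rcases hs with rfl | rfl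
      · simp
      · simpa using bu_lap_neg (p := q) (x := x)
    have hm' : ∀ s : ℝ, ∀ (q : (Fin d → ℝ) → ℝ), (s = 1 ∨ s = -1) →
        ∀ x, pd i (fun y => s * q y) x = s * pd i q x := by
      intro s q hs x
      rcases hs with rfl | rfl
      · simp
      · simpa using bu_pd_neg (p := q) (x := x) i
    have := bu_grad_est (fun y t => sg * (w (y + c) (t + τ) - w y t)) x0 t0 ρ M (2 * b) hρ hM
      (by positivity) ?_ ?_ ?_ ?_ i
    · have hx0m : x0 ∈ Metric.closedBall x0 (2 * ρ) := Metric.mem_closedBall_self (by linarith)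
      have ht0m : t0 ∈ Icc (t0 - ρ) (t0 + ρ) := ⟨by linarith, by linarith⟩
      obtain ⟨q1, q2⟩ := hcd x0 hx0m t0 ht0m
      rw [hm' sg _ hsg, bu_pd_sub i (q1.differentiableAt (by norm_num))
        (q2.differentiableAt (by norm_num)),
        bu_pd_shift (p := fun y => w y (t0 + τ))] at this
      have e1 : x0 + c = x1 := by rw [hc]; abel
      have e2 : t0 + τ = t1 := by rw [hτ]; ring
      rw [e1, e2] at this
      exact this
    · refine continuousOn_const.mul (ContinuousOn.sub ?_ ?_)
      · refine h.cont.comp (f := fun q : (Fin d → ℝ) × ℝ => (q.1 + c, q.2 + τ)) (by fun_prop) ?_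
        rintro ⟨x, t⟩ ⟨hx, ht⟩
        exact ⟨hρΩ (hball2 x hx).2, hρT (htime t ht).2⟩
      · refine h.cont.mono ?_
        rintro ⟨x, t⟩ ⟨hx, ht⟩
        exact ⟨hρΩ (hball2 x hx).1, hρT (htime t ht).1⟩
    · intro x hx t ht
      exact contDiffAt_const.mul ((hcd x hx t ht).1.sub (hcd x hx t ht).2)
    · intro x hx t ht
      have g1 := hg _ (hρΩ (hball2 x hx).2) _ (hρT (htime t ht).2)
      have g2 := hg _ (hρΩ (hball2 x hx).1) _ (hρT (htime t ht).1)
      refine ⟨sg * (g (x + c) (t + τ) - g x t), ?_, ?_⟩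
      · rw [abs_mul, hsgabs, one_mul]
        calc _ ≤ |g (x + c) (t + τ)| + |g x t| := abs_sub _ _
          _ ≤ _ := by linarith
      · rw [hm sg _ hsg, bu_lap_sub (hcd x hx t ht).1 (hcd x hx t ht).2,
          bu_lap_shift (p := fun y => w y (t + τ))]
        have k1 := (h.pde _ (hρΩ (hball2 x hx).2) _ (hρT (htime t ht).2)).comp_add_const t τ
        have k2 := h.pde _ (hρΩ (hball2 x hx).1) _ (hρT (htime t ht).1)
        refine ((k1.fun_sub k2).const_mul sg).congr_deriv ?_
        ring
    · intro x hx t ht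
      rw [abs_mul, hsgabs, one_mul]
      have := hδM (x + c, t + τ) ⟨(hball2 x hx).2, (htime t ht).2⟩ (x, t)
        ⟨(hball2 x hx).1, (htime t ht).1⟩ ?_
      · rw [Real.dist_eq] at this
        exact this.le
      · rw [Prod.dist_eq, max_lt_iff] at hdδ ⊢
        simp only [dist_eq_norm] at hdδ ⊢
        simp only [add_sub_cancel_left]
        exact hdδ
  rw [Real.dist_eq, abs_lt]
  have k1 := hcore 1 (Or.inl rfl)
  have k2 := hcore (-1) (Or.inr rfl)
  exact ⟨by linarith, by linarith⟩

set_option maxHeartbeats 1000000 in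
/-- One-sided version of the uniform right differentiability in time. -/
lemma BUSol.right_le {d : ℕ} {Ω : Set (Fin d → ℝ)} {T : ℝ} {w g : (Fin d → ℝ) → ℝ → ℝ}
    (h : BUSol Ω T w g) (hΩ : IsOpen Ω)
    (hg : ContinuousOn (fun q : (Fin d → ℝ) × ℝ => g q.1 q.2) (Ω ×ˢ Ioo 0 T))
    {t1 : ℝ} (ht1 : t1 ∈ Ioo 0 T) {K : Set (Fin d → ℝ)} (hK : IsCompact K) (hKΩ : K ⊆ Ω)
    {ε : ℝ} (hε : 0 < ε) :
    ∃ τ > 0, ∀ x ∈ K, ∀ t ∈ Icc t1 (t1 + τ),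
      w x t - w x t1 ≤ (t - t1) * (lap (fun y => w y t1) x + g x t1 + ε) := by
  obtain ⟨r0, hr0, hr0Ω⟩ := hK.exists_cthickening_subset_open hΩ hKΩ
  set K' := Metric.cthickening r0 K with hK'
  have hK'c : IsCompact K' := hK.cthickening
  obtain ⟨τ0, hτ0, hτsub⟩ : ∃ τ0 > 0, Icc t1 (t1 + τ0) ⊆ Ioo 0 T := by
    refine ⟨(T - t1) / 2, by linarith [ht1.2], fun s hs => ⟨by linarith [hs.1, ht1.1], ?_⟩⟩
    linarith [hs.2, ht1.2]
  set Q := K' ×ˢ Icc t1 (t1 + τ0) with hQ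
  have hQc : IsCompact Q := hK'c.prod isCompact_Icc
  have hQs : Q ⊆ Ω ×ˢ Ioo 0 T := prod_mono hr0Ω hτsub
  -- continuity of the Laplacian at time t1
  have hlapc : ContinuousOn (fun x => lap (fun y => w y t1) x) Ω := by
    intro x hx
    apply ContinuousAt.continuousWithinAt
    unfold lap
    refine tendsto_finsetSum _ fun i _ => ?_
    have := (bu_pd_contDiffAt i (h.c2 t1 ht1 x hx)).continuousAt_fderiv (by norm_num)
    unfold pd at this ⊢
    exact this.clm_apply continuousAt_const
  have ucl := hK'c.uniformContinuousOn_of_continuous (hlapc.mono hr0Ω)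
  have ucg := hQc.uniformContinuousOn_of_continuous (hg.mono hQs)
  have ucw := hQc.uniformContinuousOn_of_continuous (h.cont.mono hQs)
  obtain ⟨δ1, hδ1, H1⟩ := Metric.uniformContinuousOn_iff.1 ucl (ε / 4) (by linarith)
  obtain ⟨δ2, hδ2, H2⟩ := Metric.uniformContinuousOn_iff.1 ucg (ε / 4) (by linarith)
  set r := min r0 (min (δ1 / 2) (δ2 / 2)) with hr
  have hrpos : 0 < r := by positivity
  have hrr0 : r ≤ r0 := min_le_left _ _
  have hrδ1 : r < δ1 := by
    have : r ≤ δ1 / 2 := (min_le_right _ _).trans (min_le_left _ _)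
    linarith
  have hrδ2 : r < δ2 := by
    have : r ≤ δ2 / 2 := (min_le_right _ _).trans (min_le_right _ _)
    linarith
  set κ := ε / (8 * (d + 1)) with hκ
  have hd0 : (0:ℝ) ≤ d := Nat.cast_nonneg d
  have hκ0 : 0 < κ := by positivity
  have hκd : 2 * κ * d ≤ ε / 4 := by
    have : κ * (d + 1) = ε / 8 := by rw [hκ]; field_simp
    nlinarith
  obtain ⟨δ3, hδ3, H3⟩ := Metric.uniformContinuousOn_iff.1 ucw (κ * r ^ 2 / 2) (by positivity)
  -- bound for the speed on K
  obtain ⟨A, hA⟩ := hK.exists_bound_of_continuousOn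
    (f := fun x => lap (fun y => w y t1) x + g x t1 + ε)
    (((hlapc.mono hKΩ).add (hg.comp (f := fun x => (x, t1)) (by fun_prop)
      (fun x hx => ⟨hKΩ hx, ht1⟩))).add continuousOn_const)
  set A' := |A| + 1 with hA'
  have hA'0 : 0 < A' := by positivity
  set τ := min (min τ0 (δ2 / 2)) (min (δ3 / 2) (κ * r ^ 2 / 2 / A')) with hτ
  have hτpos : 0 < τ := by positivity
  have hττ0 : τ ≤ τ0 := (min_le_left _ _).trans (min_le_left _ _)
  have hτδ2 : τ < δ2 := by
    have : τ ≤ δ2 / 2 := (min_le_left _ _).trans (min_le_right _ _)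
    linarith
  have hτδ3 : τ < δ3 := by
    have : τ ≤ δ3 / 2 := (min_le_right _ _).trans (min_le_left _ _)
    linarith
  have hτA : τ * A' ≤ κ * r ^ 2 / 2 := by
    have : τ ≤ κ * r ^ 2 / 2 / A' := (min_le_right _ _).trans (min_le_right _ _)
    rwa [le_div_iff₀ hA'0] at this
  refine ⟨τ, hτpos, ?_⟩
  intro x hx
  have hballK' : Metric.closedBall x r ⊆ K' :=
    (Metric.closedBall_subset_closedBall hrr0).trans (Metric.closedBall_subset_cthickening hx r0)
  have hxK' : x ∈ K' := hballK' (Metric.mem_closedBall_self hrpos.le)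
  set v := lap (fun y => w y t1) x + g x t1 + ε with hv
  have hvA : |v| ≤ A' := by
    have := hA x hx
    rw [Real.norm_eq_abs] at this
    linarith [le_abs_self A]
  have hIcc : Icc t1 (t1 + τ) ⊆ Icc t1 (t1 + τ0) := Icc_subset_Icc_right (by linarith)
  set E : (Fin d → ℝ) × ℝ → ℝ := fun p =>
    w p.1 p.2 - w p.1 t1 - (p.2 - t1) * v - κ * ∑ j, (p.1 j - x j) ^ 2 with hE
  have hCc : IsCompact (Metric.closedBall x r ×ˢ Icc t1 (t1 + τ)) :=
    (isCompact_closedBall _ _).prod isCompact_Icc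
  have hEc : ContinuousOn E (Metric.closedBall x r ×ˢ Icc t1 (t1 + τ)) := by
    refine ((ContinuousOn.sub ?_ ?_).sub (by fun_prop)).sub (by fun_prop)
    · exact h.cont.mono ((prod_mono hballK' hIcc).trans hQs)
    · refine h.cont.comp (f := fun p : (Fin d → ℝ) × ℝ => (p.1, t1)) (by fun_prop) ?_
      rintro ⟨y, s⟩ ⟨hy, _⟩
      exact ⟨hr0Ω (hballK' hy), ht1⟩
  have hmem : ((x, t1) : (Fin d → ℝ) × ℝ) ∈ Metric.closedBall x r ×ˢ Icc t1 (t1 + τ) :=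
    ⟨Metric.mem_closedBall_self hrpos.le, ⟨le_rfl, by linarith⟩⟩
  have key : ∀ p ∈ Metric.closedBall x r ×ˢ Icc t1 (t1 + τ), E p ≤ 0 := by
    by_contra hcon
    push Not at hcon
    obtain ⟨p0, hp0, hp0pos⟩ := hcon
    obtain ⟨⟨y, t⟩, ⟨hy, ht⟩, hmax⟩ := hCc.exists_isMaxOn ⟨_, hmem⟩ hEc
    have hEpos : 0 < E (y, t) := lt_of_lt_of_le hp0pos (hmax hp0)
    simp only at hy ht
    have hsum0 : 0 ≤ ∑ j, (y j - x j) ^ 2 := Finset.sum_nonneg fun j _ => sq_nonneg _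
    have hks := mul_nonneg hκ0.le hsum0
    have hEv : E (y, t) = w y t - w y t1 - (t - t1) * v - κ * ∑ j, (y j - x j) ^ 2 := rfl
    have htpos : t1 < t := by
      rcases ht.1.lt_or_eq with h' | h'
      · exact h'
      · exfalso
        rw [← h'] at hEv hEpos
        simp at hEv
        linarith
    have hyK' := hballK' hy
    have htI := hIcc ht
    have hsmall : w y t - w y t1 < κ * r ^ 2 / 2 := by
      have := H3 (y, t) ⟨hyK', htI⟩ (y, t1) ⟨hyK', ⟨le_rfl, by linarith⟩⟩ ?_
      · rw [Real.dist_eq] at this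
        exact (abs_lt.1 this).2
      · rw [Prod.dist_eq, max_lt_iff]
        simp only [dist_self, Real.dist_eq]
        refine ⟨hδ3, ?_⟩
        rw [abs_of_nonneg (by linarith)]
        linarith [ht.2]
    have hsp : - ((t - t1) * v) ≤ κ * r ^ 2 / 2 := by
      calc - ((t - t1) * v) ≤ |(t - t1) * v| := neg_le_abs _
        _ = (t - t1) * |v| := by rw [abs_mul, abs_of_nonneg (by linarith)]
        _ ≤ τ * A' := by
          apply mul_le_mul (by linarith [ht.2]) hvA (abs_nonneg _) hτpos.le
        _ ≤ _ := hτA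
    have hyb : y ∈ Metric.ball x r := by
      rw [mem_ball_iff_norm]
      by_contra hcon
      push Not at hcon
      have h1 : r ^ 2 ≤ ‖y - x‖ ^ 2 := by gcongr
      have h2 := bu_norm_sq_le_sum (y - x)
      simp only [Pi.sub_apply] at h2
      have := mul_le_mul_of_nonneg_left (h1.trans h2) hκ0.le
      linarith
    have hyΩ := hr0Ω hyK'
    have htT := hτsub htI
    -- space second derivatives
    have hymax : IsLocalMax (fun z => (w z t - w z t1) - κ * ∑ j, (z j - x j) ^ 2) y := by
      filter_upwards [Metric.isOpen_ball.mem_nhds hyb] with z hz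
      have : E (z, t) ≤ E (y, t) := hmax ⟨Metric.ball_subset_closedBall hz, ht⟩
      simp only [hE] at this
      linarith
    have hlap : lap (fun z => w z t) y - lap (fun z => w z t1) y ≤ 2 * κ * d := by
      rw [← bu_lap_sub (h.c2 t htT y hyΩ) (h.c2 t1 ht1 y hyΩ)]
      unfold lap
      calc _ ≤ ∑ j : Fin d, 2 * κ := Finset.sum_le_sum fun j _ =>
            bu_pd2_le j ((h.c2 t htT y hyΩ).sub (h.c2 t1 ht1 y hyΩ)) hymax
        _ = 2 * κ * d := by simp; ring
    -- time derivative
    have hder : HasDerivAt (fun s => w y s - s * v) (lap (fun z => w z t) y + g y t - v) t := by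
      refine ((h.pde y hyΩ t htT).fun_sub ((hasDerivAt_id' t).mul_const v)).congr_deriv ?_
      ring
    have hge : 0 ≤ lap (fun z => w z t) y + g y t - v := by
      have hlim := hder.tendsto_slope_zero_left
      refine ge_of_tendsto hlim ?_
      have : ∀ᶠ s in 𝓝[<] (0:ℝ), s ∈ Ioo (t1 - t) 0 := Ioo_mem_nhdsLT (by linarith)
      filter_upwards [this] with s hs
      have h1 : E (y, t + s) ≤ E (y, t) := hmax ⟨hy, ⟨by linarith [hs.1], by linarith [hs.2, ht.2]⟩⟩
      simp only [hE] at h1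
      rw [smul_eq_mul]
      apply mul_nonneg_of_nonpos_of_nonpos
      · exact inv_nonpos.2 hs.2.le
      · linarith
    have hl1 : lap (fun z => w z t1) y - lap (fun z => w z t1) x < ε / 4 := by
      have := H1 y hyK' x hxK' (lt_of_le_of_lt (Metric.mem_closedBall.1 hy) hrδ1)
      rw [Real.dist_eq] at this
      exact (abs_lt.1 this).2
    have hg1 : g y t - g x t1 < ε / 4 := by
      have := H2 (y, t) ⟨hyK', htI⟩ (x, t1) ⟨hxK', ⟨le_rfl, by linarith⟩⟩ ?_
      · rw [Real.dist_eq] at this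
        exact (abs_lt.1 this).2
      · rw [Prod.dist_eq, max_lt_iff]
        refine ⟨lt_of_le_of_lt (Metric.mem_closedBall.1 hy) hrδ2, ?_⟩
        simp only [Real.dist_eq]
        rw [abs_of_nonneg (by linarith)]
        linarith [ht.2]
    linarith
  intro t ht
  have := key (x, t) ⟨Metric.mem_closedBall_self hrpos.le, ht⟩
  simp only [hE] at this
  simp at this
  linarith

/-- Uniform right differentiability in time. -/
lemma BUSol.right_deriv {d : ℕ} {Ω : Set (Fin d → ℝ)} {T : ℝ} {w g : (Fin d → ℝ) → ℝ → ℝ}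
    (h : BUSol Ω T w g) (hΩ : IsOpen Ω)
    (hg : ContinuousOn (fun q : (Fin d → ℝ) × ℝ => g q.1 q.2) (Ω ×ˢ Ioo 0 T))
    {t1 : ℝ} (ht1 : t1 ∈ Ioo 0 T) {K : Set (Fin d → ℝ)} (hK : IsCompact K) (hKΩ : K ⊆ Ω)
    {ε : ℝ} (hε : 0 < ε) :
    ∃ τ > 0, ∀ x ∈ K, ∀ t ∈ Icc t1 (t1 + τ),
      |w x t - w x t1 - (t - t1) * (lap (fun y => w y t1) x + g x t1)| ≤ (t - t1) * ε := by
  obtain ⟨τ1, hτ1, H1⟩ := h.right_le hΩ hg ht1 hK hKΩ hε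
  obtain ⟨τ2, hτ2, H2⟩ := h.neg.right_le hΩ hg.neg ht1 hK hKΩ hε
  refine ⟨min τ1 τ2, by positivity, fun x hx t ht => ?_⟩
  have h1 := H1 x hx t ⟨ht.1, ht.2.trans (by linarith [min_le_left τ1 τ2])⟩
  have h2 := H2 x hx t ⟨ht.1, ht.2.trans (by linarith [min_le_right τ1 τ2])⟩
  rw [bu_lap_neg] at h2
  rw [abs_le]
  constructor <;> nlinarith

lemma bu_int_cpt {d : ℕ} {K : Set (Fin d → ℝ)} (hK : IsCompact K) {F : (Fin d → ℝ) → ℝ}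
    (hF : ContinuousOn F K) (h0 : ∀ x ∉ K, F x = 0) : Integrable F := by
  rw [← integrableOn_iff_integrable_of_support_subset (s := K)]
  · exact hF.integrableOn_compact hK
  · intro x hx
    by_contra hxK
    exact hx (h0 x hxK)

lemma bu_pd_cont_of_c1 {d : ℕ} {q : (Fin d → ℝ) → ℝ} {x : Fin d → ℝ} (i : Fin d)
    (h : ContDiffAt ℝ 1 q x) : ContinuousAt (pd i q) x := by
  have h1 : ContDiffAt ℝ 0 (fderiv ℝ q) x := h.fderiv_right (by norm_num)
  exact h1.continuousAt.clm_apply continuousAt_const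

lemma bu_pd_zero_off {d : ℕ} {ψ : (Fin d → ℝ) → ℝ} {x : Fin d → ℝ} (i : Fin d)
    (hx : x ∉ tsupport ψ) : pd i ψ x = 0 := by
  have : ψ =ᶠ[𝓝 x] fun _ => 0 := notMem_tsupport_iff_eventuallyEq.1 hx
  unfold pd
  rw [this.fderiv_eq]
  simp

lemma bu_lap_cont {d : ℕ} {q : (Fin d → ℝ) → ℝ} {x : Fin d → ℝ}
    (h : ContDiffAt ℝ 2 q x) : ContinuousAt (lap q) x := by
  unfold lap
  exact tendsto_finsetSum _ fun i _ => bu_pd_cont_of_c1 i (bu_pd_contDiffAt i h)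

lemma bu_ibp {d : ℕ} {Ω : Set (Fin d → ℝ)} {q ψ : (Fin d → ℝ) → ℝ}
    (hq : ∀ x ∈ Ω, ContDiffAt ℝ 2 q x) (hψ : ContDiff ℝ 1 ψ) (hc : HasCompactSupport ψ)
    (hs : tsupport ψ ⊆ Ω) :
    ∫ x, lap q x * ψ x = - ∑ i, ∫ x, pd i q x * pd i ψ x := by
  have hz : ∀ x ∉ tsupport ψ, ψ x = 0 := fun x hx => image_eq_zero_of_notMem_tsupport hx
  have c1 : ∀ i, ContinuousOn (pd i (pd i q)) (tsupport ψ) := fun i x hx =>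
    (bu_pd_cont_of_c1 i (bu_pd_contDiffAt i (hq x (hs hx)))).continuousWithinAt
  have c2 : ∀ i, ContinuousOn (pd i q) (tsupport ψ) := fun i x hx =>
    (bu_pd_diff i (hq x (hs hx))).continuousAt.continuousWithinAt
  have c3 : ∀ i, Continuous (pd i ψ) := fun i =>
    continuous_iff_continuousAt.2 fun x => bu_pd_cont_of_c1 i hψ.contDiffAt
  have i1 : ∀ i, Integrable (fun x => pd i (pd i q) x * ψ x) := fun i =>
    bu_int_cpt hc ((c1 i).mul hψ.continuous.continuousOn) fun x hx => by rw [hz x hx, mul_zero]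
  have i2 : ∀ i, Integrable (fun x => pd i q x * pd i ψ x) := fun i =>
    bu_int_cpt hc ((c2 i).mul (c3 i).continuousOn) fun x hx => by
      rw [bu_pd_zero_off i hx, mul_zero]
  have i3 : ∀ i, Integrable (fun x => pd i q x * ψ x) := fun i =>
    bu_int_cpt hc ((c2 i).mul hψ.continuous.continuousOn) fun x hx => by rw [hz x hx, mul_zero]
  have key : ∀ i, ∫ x, pd i q x * pd i ψ x = - ∫ x, pd i (pd i q) x * ψ x := fun i =>
    integral_mul_fderiv_eq_neg_fderiv_mul_of_integrable (i1 i) (i2 i) (i3 i)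
      (fun x hx => bu_pd_diff i (hq x (hs hx)))
      (fun x _ => hψ.differentiable (by norm_num) x)
  simp only [key, Finset.sum_neg_distrib, neg_neg]
  rw [← integral_finsetSum _ fun i _ => i1 i]
  simp only [lap, Finset.sum_mul]

lemma bu_param_cont {d : ℕ} {Ω : Set (Fin d → ℝ)} (hΩ : IsOpen Ω) {T : ℝ}
    {v : (Fin d → ℝ) → ℝ → ℝ}
    (hv : ContinuousOn (fun q : (Fin d → ℝ) × ℝ => v q.1 q.2) (Ω ×ˢ Ioo 0 T))
    {K : Set (Fin d → ℝ)} (hK : IsCompact K) (hKΩ : K ⊆ Ω)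
    {ψ : (Fin d → ℝ) → ℝ} (hψ : Continuous ψ) (h0 : ∀ x ∉ K, ψ x = 0) :
    ContinuousOn (fun t => ∫ x, v x t * ψ x) (Ioo 0 T) := by
  apply continuousOn_integral_of_compact_support (f := fun t x => v x t * ψ x) hK
  · rintro ⟨t, x⟩ ⟨ht, -⟩
    simp only at ht
    apply ContinuousAt.continuousWithinAt
    by_cases hx : x ∈ Ω
    · have h1 : ContinuousAt (fun q : (Fin d → ℝ) × ℝ => v q.1 q.2) (x, t) :=
        hv.continuousAt ((hΩ.prod isOpen_Ioo).mem_nhds ⟨hx, ht⟩)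
      have h2 : ContinuousAt (fun q : ℝ × (Fin d → ℝ) => v q.2 q.1) (t, x) :=
        ContinuousAt.comp (x := (t, x)) (g := fun q : (Fin d → ℝ) × ℝ => v q.1 q.2)
          (f := fun q : ℝ × (Fin d → ℝ) => (q.2, q.1)) h1 (by fun_prop)
      exact h2.mul (by fun_prop)
    · have h1 : ∀ᶠ q : ℝ × (Fin d → ℝ) in 𝓝 (t, x), q.2 ∈ Kᶜ := by
        apply continuous_snd.continuousAt.eventually
        exact hK.isClosed.isOpen_compl.mem_nhds fun hxK => hx (hKΩ hxK)
      have h2 : (Function.uncurry fun t x => v x t * ψ x) =ᶠ[𝓝 (t, x)] fun _ => (0:ℝ) := by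
        filter_upwards [h1] with q hq
        simp [Function.uncurry, h0 _ hq]
      exact continuousAt_const.congr h2.symm
  · intro t x _ hx
    rw [h0 x hx, mul_zero]

/-- The weak form against compactly supported test functions. -/
lemma BUSol.weak {d : ℕ} {Ω : Set (Fin d → ℝ)} {T : ℝ} {w g : (Fin d → ℝ) → ℝ → ℝ}
    (h : BUSol Ω T w g) (hΩ : IsOpen Ω)
    (hg : ContinuousOn (fun q : (Fin d → ℝ) × ℝ => g q.1 q.2) (Ω ×ˢ Ioo 0 T))
    (hpd : ∀ i, ContinuousOn (fun q : (Fin d → ℝ) × ℝ => pd i (fun y => w y q.2) q.1) (Ω ×ˢ Ioo 0 T))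
    {ψ : (Fin d → ℝ) → ℝ} (hψ : ContDiff ℝ 1 ψ) (hc : HasCompactSupport ψ) (hs : tsupport ψ ⊆ Ω)
    {t1 t2 : ℝ} (ht1 : t1 ∈ Ioo 0 T) (ht2 : t2 ∈ Ioo 0 T) (h12 : t1 ≤ t2) :
    (∫ x, w x t2 * ψ x) - ∫ x, w x t1 * ψ x =
      ∫ t in t1..t2, (- (∑ i, ∫ x, pd i (fun y => w y t) x * pd i ψ x) + ∫ x, g x t * ψ x) := by
  have hz : ∀ x ∉ tsupport ψ, ψ x = 0 := fun x hx => image_eq_zero_of_notMem_tsupport hx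
  have hsub : Icc t1 t2 ⊆ Ioo 0 T := fun t ht => ⟨ht1.1.trans_le ht.1, ht.2.trans_lt ht2.2⟩
  have cF : ContinuousOn (fun t => ∫ x, w x t * ψ x) (Ioo 0 T) :=
    bu_param_cont hΩ h.cont hc hs hψ.continuous hz
  have cG : ContinuousOn (fun t => ∫ x, g x t * ψ x) (Ioo 0 T) :=
    bu_param_cont hΩ hg hc hs hψ.continuous hz
  have c3 : ∀ i, Continuous (pd i ψ) := fun i =>
    continuous_iff_continuousAt.2 fun x => bu_pd_cont_of_c1 i hψ.contDiffAt
  have cZ : ∀ i, ContinuousOn (fun t => ∫ x, pd i (fun y => w y t) x * pd i ψ x) (Ioo 0 T) :=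
    fun i => bu_param_cont (v := fun x t => pd i (fun y => w y t) x) hΩ (hpd i) hc hs (c3 i)
      fun x hx => bu_pd_zero_off i hx
  symm
  apply intervalIntegral.integral_eq_sub_of_hasDeriv_right_of_le h12 (cF.mono hsub)
    (f := fun t => ∫ x, w x t * ψ x)
  swap
  · apply ContinuousOn.intervalIntegrable
    rw [uIcc_of_le h12]
    exact (((continuousOn_finsetSum _ fun i _ => cZ i).neg).add cG).mono hsub
  intro t ht'
  have ht : t ∈ Ioo 0 T := hsub (Ioo_subset_Icc_self ht')
  rw [← bu_ibp (h.c2 t ht) hψ hc hs]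
  have csl : ∀ {v : (Fin d → ℝ) → ℝ → ℝ}, ContinuousOn (fun q : (Fin d → ℝ) × ℝ => v q.1 q.2) (Ω ×ˢ Ioo 0 T) →
      ∀ s ∈ Ioo 0 T, Integrable (fun x => v x s * ψ x) := by
    intro v hv s hs'
    refine bu_int_cpt hc (ContinuousOn.mul ?_ hψ.continuous.continuousOn) fun x hx => by rw [hz x hx, mul_zero]
    exact hv.comp (f := fun x => (x, s)) (by fun_prop) fun x hx => ⟨hs hx, hs'⟩
  have iL : Integrable (fun x => lap (fun y => w y t) x * ψ x) :=
    bu_int_cpt hc (ContinuousOn.mul (fun x hx => (bu_lap_cont (h.c2 t ht x (hs hx))).continuousWithinAt)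
      hψ.continuous.continuousOn) fun x hx => by rw [hz x hx, mul_zero]
  rw [hasDerivWithinAt_iff_isLittleO, Asymptotics.isLittleO_iff]
  intro c hcpos
  set M := ∫ x, ‖ψ x‖ with hM
  have hM0 : 0 ≤ M := integral_nonneg fun x => norm_nonneg _
  obtain ⟨τ, hτ, hτe⟩ := h.right_deriv hΩ hg ht hc hs (ε := c / (M + 1)) (by positivity)
  have hnb : Ioo t (min (t + τ) T) ∈ 𝓝[>] t := Ioo_mem_nhdsGT (lt_min (by linarith) ht.2)
  filter_upwards [hnb] with r hr
  have hr1 : r ∈ Ioo 0 T := ⟨ht.1.trans hr.1, hr.2.trans_le (min_le_right _ _)⟩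
  have hr2 : r ∈ Icc t (t + τ) := ⟨hr.1.le, (hr.2.trans_le (min_le_left _ _)).le⟩
  have hrt : 0 < r - t := sub_pos.2 hr.1
  have e1 : (∫ x, w x r * ψ x) - (∫ x, w x t * ψ x) - (r - t) • ((∫ x, lap (fun y => w y t) x * ψ x)
      + ∫ x, g x t * ψ x) = ∫ x, (w x r - w x t - (r - t) * (lap (fun y => w y t) x + g x t)) * ψ x := by
    rw [← integral_add iL (csl hg t ht), smul_eq_mul, ← integral_const_mul,
      ← integral_sub (csl h.cont r hr1) (csl h.cont t ht), ← integral_sub]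
    · congr 1; ext x; ring
    · exact (csl h.cont r hr1).sub (csl h.cont t ht)
    · exact (iL.add (csl hg t ht)).const_mul _
  rw [e1]
  calc _ ≤ ∫ x, (r - t) * (c / (M + 1)) * ‖ψ x‖ := by
        apply norm_integral_le_of_norm_le
        · exact (hψ.continuous.integrable_of_hasCompactSupport hc).norm.const_mul _
        · refine Eventually.of_forall fun x => ?_
          by_cases hx : x ∈ tsupport ψ
          · rw [norm_mul]
            exact mul_le_mul_of_nonneg_right (hτe x hx r hr2) (norm_nonneg _)
          · simp [hz x hx]
    _ = (r - t) * c * (M / (M + 1)) := by rw [integral_const_mul, ← hM]; ring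
    _ ≤ (r - t) * c * 1 := by
        gcongr
        rw [div_le_one (by positivity)]; linarith
    _ = _ := by rw [Real.norm_eq_abs, abs_of_pos hrt]; ring

open Classical in
/-- The `L²` class of a function (zero if it is not square integrable). -/
noncomputable def buH {α : Type*} [MeasurableSpace α] (μ : Measure α) (f : α → ℝ) : Lp ℝ 2 μ :=
  if h : MemLp f 2 μ then h.toLp f else 0

lemma buH_coe {α : Type*} [MeasurableSpace α] {μ : Measure α} {f : α → ℝ} (h : MemLp f 2 μ) :
    buH μ f =ᵐ[μ] f := by
  unfold buH
  rw [dif_pos h]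
  exact h.coeFn_toLp

lemma buH_inner' {α : Type*} [MeasurableSpace α] {μ : Measure α} {f : α → ℝ} (h : MemLp f 2 μ)
    (A : Lp ℝ 2 μ) : inner ℝ A (buH μ f) = ∫ x, A x * f x ∂μ := by
  rw [L2.inner_def]
  refine integral_congr_ae ?_
  filter_upwards [buH_coe h] with x hx
  rw [hx]
  simp [mul_comm]

lemma buH_inner {α : Type*} [MeasurableSpace α] {μ : Measure α} {f k : α → ℝ} (hk : MemLp k 2 μ)
    (h : MemLp f 2 μ) : inner ℝ (buH μ k) (buH μ f) = ∫ x, k x * f x ∂μ := by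
  rw [buH_inner' h]
  refine integral_congr_ae ?_
  filter_upwards [buH_coe hk] with x hx
  rw [hx]

lemma buH_sub {α : Type*} [MeasurableSpace α] {μ : Measure α} {f k : α → ℝ} (hk : MemLp k 2 μ)
    (h : MemLp f 2 μ) : buH μ k - buH μ f = buH μ (fun x => k x - f x) := by
  apply Lp.ext
  filter_upwards [Lp.coeFn_sub (buH μ k) (buH μ f), buH_coe hk, buH_coe h, buH_coe (hk.sub h)]
    with x h1 h2 h3 h4
  rw [h1]
  simp only [Pi.sub_apply, h2, h3]
  exact h4.symm

lemma buH_norm {α : Type*} [MeasurableSpace α] {μ : Measure α} {f : α → ℝ}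
    (h : MemLp f 2 μ) : ‖buH μ f‖ ^ 2 = ∫ x, f x ^ 2 ∂μ := by
  rw [← real_inner_self_eq_norm_sq, buH_inner h h]
  simp only [sq]

lemma buH_tendsto {α ι : Type*} [MeasurableSpace α] {μ : Measure α} [IsFiniteMeasure μ]
    {l : Filter ι} [l.IsCountablyGenerated] {v : ι → α → ℝ} {v0 : α → ℝ} {R : ℝ}
    (hv : ∀ᶠ t in l, AEStronglyMeasurable (v t) μ) (hb : ∀ᶠ t in l, ∀ᵐ x ∂μ, |v t x| ≤ R)
    (h0 : AEStronglyMeasurable v0 μ) (hb0 : ∀ᵐ x ∂μ, |v0 x| ≤ R)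
    (hlim : ∀ᵐ x ∂μ, Tendsto (fun t => v t x) l (𝓝 (v0 x))) :
    Tendsto (fun t => buH μ (v t)) l (𝓝 (buH μ v0)) := by
  rw [tendsto_iff_norm_sub_tendsto_zero]
  have m0 : MemLp v0 2 μ := MemLp.of_bound h0 R hb0
  have h2 : Tendsto (fun t => ‖buH μ (v t) - buH μ v0‖ ^ 2) l (𝓝 0) := by
    have h3 : Tendsto (fun t => ∫ x, (v t x - v0 x) ^ 2 ∂μ) l (𝓝 (∫ x, (0:ℝ) ∂μ)) := by
      apply tendsto_integral_filter_of_dominated_convergence (fun _ => (2 * R) ^ 2)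
      · filter_upwards [hv] with t ht
        exact (ht.sub h0).pow 2
      · filter_upwards [hb] with t ht
        filter_upwards [ht, hb0] with x hx hx0
        rw [norm_pow, Real.norm_eq_abs]
        have : |v t x - v0 x| ≤ 2 * R := (abs_sub _ _).trans (by linarith)
        gcongr
      · exact integrable_const _
      · filter_upwards [hlim] with x hx
        have := (hx.sub_const (v0 x)).pow 2
        simpa using this
    rw [integral_zero] at h3
    refine h3.congr' ?_
    filter_upwards [hv, hb] with t ht ht'
    have mt : MemLp (v t) 2 μ := MemLp.of_bound ht R ht'
    rw [buH_sub mt m0]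
    exact (buH_norm (mt.sub m0)).symm
  have := h2.sqrt
  simpa using this

lemma buH_weak_tendsto {α : Type*} [MeasurableSpace α] {μ : Measure α} [IsFiniteMeasure μ]
    {v : ℕ → α → ℝ} {v0 : α → ℝ} {R : ℝ}
    (hv : ∀ n, AEStronglyMeasurable (v n) μ) (hb : ∀ n, ∀ᵐ x ∂μ, |v n x| ≤ R)
    (h0 : AEStronglyMeasurable v0 μ) (hb0 : ∀ᵐ x ∂μ, |v0 x| ≤ R)
    (hlim : ∀ᵐ x ∂μ, Tendsto (fun n => v n x) atTop (𝓝 (v0 x))) (A : Lp ℝ 2 μ) :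
    Tendsto (fun n => inner ℝ A (buH μ (v n))) atTop (𝓝 (inner ℝ A (buH μ v0))) :=
  tendsto_const_nhds.inner (buH_tendsto (R := R) (Eventually.of_forall hv) (Eventually.of_forall hb) h0 hb0 hlim)

lemma bu_trunc : ∃ (S : ℝ → ℝ) (C : ℝ), ContDiff ℝ 1 S ∧ (∀ r, |r| ≤ 1 → S r = 0) ∧
    (∀ r, 2 ≤ |r| → S r = r) ∧ (∀ r, |S r| ≤ |r|) ∧ (∀ r, |deriv S r| ≤ C) ∧ 1 ≤ C := by
  set S : ℝ → ℝ := fun r => r * Real.smoothTransition (r ^ 2 - 1) with hS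
  have hS1 : ContDiff ℝ 1 S := by
    have : ContDiff ℝ 1 Real.smoothTransition := Real.smoothTransition.contDiff
    apply contDiff_id.mul
    exact this.comp (by fun_prop)
  have hbig : ∀ r, 2 ≤ r ^ 2 → S r = r := by
    intro r hr
    simp only [hS]
    rw [Real.smoothTransition.one_of_one_le (by linarith), mul_one]
  have hd : ∀ r, 2 < |r| → deriv S r = 1 := by
    intro r hr
    have : S =ᶠ[𝓝 r] id := by
      have : ∀ᶠ s in 𝓝 r, 2 < |s| := continuous_abs.continuousAt.eventually_const_lt hr
      filter_upwards [this] with s hs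
      apply hbig
      rw [← sq_abs]; nlinarith
    rw [this.deriv_eq]
    simp
  obtain ⟨C, hC⟩ := (isCompact_Icc (a := (-2:ℝ)) (b := 2)).exists_bound_of_continuousOn
    (hS1.continuous_deriv (by norm_num)).continuousOn
  refine ⟨S, max C 1, hS1, ?_, ?_, ?_, ?_, le_max_right _ _⟩
  · intro r hr
    simp only [hS]
    rw [Real.smoothTransition.zero_of_nonpos, mul_zero]
    rw [← sq_abs]; nlinarith [abs_nonneg r]
  · intro r hr
    apply hbig
    rw [← sq_abs]; nlinarith
  · intro r
    simp only [hS]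
    rw [abs_mul, abs_of_nonneg (Real.smoothTransition.nonneg _)]
    exact mul_le_of_le_one_right (abs_nonneg _) (Real.smoothTransition.le_one _)
  · intro r
    rcases le_or_gt |r| 2 with h | h
    · exact (hC r (abs_le.1 h)).trans (le_max_left _ _)
    · rw [hd r h]; simp

lemma bu_grad_zero {d : ℕ} {Ω : Set (Fin d → ℝ)} (hΩ : IsOpen Ω) {q : (Fin d → ℝ) → ℝ}
    (hq : ∀ x ∈ Ω, DifferentiableAt ℝ q x) (i : Fin d) :
    ∀ᵐ x ∂(volume.restrict Ω), q x = 0 → pd i q x = 0 := by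
  set s := Ω ∩ q ⁻¹' {0} with hs
  have hqc : ContinuousOn q Ω := fun x hx => (hq x hx).continuousAt.continuousWithinAt
  have hsm : MeasurableSet s := by
    have : s = Ω \ (Ω ∩ q ⁻¹' {0}ᶜ) := by ext x; simp [hs]
    rw [this]
    exact hΩ.measurableSet.diff (hqc.isOpen_inter_preimage hΩ isOpen_compl_singleton).measurableSet
  set v : Fin d → ℝ := Pi.single i 1 with hv
  have hA : ApproximatesLinearOn (fun x => q x • v) (0 : (Fin d → ℝ) →L[ℝ] (Fin d → ℝ)) s 0 := by
    intro x hx y hy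
    have h1 : q x = 0 := hx.2
    have h2 : q y = 0 := hy.2
    simp [h1, h2]
  have h1 := hA.norm_fderiv_sub_le volume hsm (fun x => (fderiv ℝ q x).smulRight v)
    (fun x hx => ((hq x hx.1).hasFDerivAt.smul_const v).hasFDerivWithinAt)
  rw [ae_restrict_iff' hsm] at h1
  rw [ae_restrict_iff' hΩ.measurableSet]
  filter_upwards [h1] with x hx hxΩ hx0
  have h2 := hx ⟨hxΩ, hx0⟩
  rw [sub_zero, nonpos_iff_eq_zero, nnnorm_eq_zero] at h2
  have h3 := congrFun (congrArg (fun L => L v) h2) i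
  simpa [hv, pd] using h3

lemma bu_test {d : ℕ} {Ω : Set (Fin d → ℝ)} (hΩ : IsOpen Ω) (hΩb : Bornology.IsBounded Ω)
    {q : (Fin d → ℝ) → ℝ} {R : ℝ} (hcl : ContinuousOn q (closure Ω))
    (h0 : ∀ x ∈ frontier Ω, q x = 0) (hq : ∀ x ∈ Ω, ContDiffAt ℝ 2 q x)
    (hR : ∀ x ∈ Ω, |q x| ≤ R) (hR' : ∀ x ∈ Ω, ∀ i, |pd i q x| ≤ R) :
    ∃ (ψ : ℕ → (Fin d → ℝ) → ℝ) (C : ℝ), R ≤ C ∧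
      (∀ n, ContDiff ℝ 1 (ψ n) ∧ HasCompactSupport (ψ n) ∧ tsupport (ψ n) ⊆ Ω) ∧
      (∀ n, ∀ x ∈ Ω, |ψ n x| ≤ C ∧ ∀ i, |pd i (ψ n) x| ≤ C) ∧
      (∀ x ∈ Ω, Tendsto (fun n => ψ n x) atTop (𝓝 (q x))) ∧
      (∀ i, ∀ᵐ x ∂(volume.restrict Ω), Tendsto (fun n => pd i (ψ n) x) atTop (𝓝 (pd i q x))) := by
  obtain ⟨S, C, hS, hS0, hS1, hSb, hSd, hC1⟩ := bu_trunc
  set N : ℕ → ℝ := fun n => (n:ℝ) + 1 with hN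
  have hNpos : ∀ n, 0 < N n := fun n => by simp only [hN]; positivity
  set ψ : ℕ → (Fin d → ℝ) → ℝ := fun n => Ω.indicator fun x => (N n)⁻¹ * S (N n * q x) with hψ
  have hψin : ∀ n, ∀ x ∈ Ω, ψ n x = (N n)⁻¹ * S (N n * q x) := fun n x hx => indicator_of_mem hx _
  have hψev : ∀ n, ∀ x ∈ Ω, ψ n =ᶠ[𝓝 x] fun x => (N n)⁻¹ * S (N n * q x) := fun n x hx => by
    filter_upwards [hΩ.mem_nhds hx] with y hy using hψin n y hy
  have hqd : ∀ x ∈ Ω, DifferentiableAt ℝ q x := fun x hx => (hq x hx).differentiableAt (by norm_num)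
  have hpd : ∀ n, ∀ x ∈ Ω, ∀ i, pd i (ψ n) x = deriv S (N n * q x) * pd i q x := by
    intro n x hx i
    unfold pd
    rw [(hψev n x hx).fderiv_eq]
    have h1 : HasFDerivAt (fun x => N n * q x) (N n • fderiv ℝ q x) x :=
      (hqd x hx).hasFDerivAt.const_mul _
    have h2 : HasDerivAt S (deriv S (N n * q x)) (N n * q x) :=
      (hS.differentiable (by norm_num) _).hasDerivAt
    have h3 := (h2.comp_hasFDerivAt x h1).const_mul (N n)⁻¹
    rw [show fderiv ℝ (fun x => (N n)⁻¹ * S (N n * q x)) x = _ from h3.fderiv]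
    simp only [smul_apply, smul_eq_mul]
    have := (hNpos n).ne'
    field_simp
  -- the support set
  set K : ℕ → Set (Fin d → ℝ) := fun n => closure Ω ∩ q ⁻¹' {r | (N n)⁻¹ ≤ |r|} with hK
  have hKc : ∀ n, IsCompact (K n) := by
    intro n
    have hcc : IsCompact (closure Ω) := hΩb.isCompact_closure
    refine hcc.of_isClosed_subset ?_ inter_subset_left
    exact hcl.preimage_isClosed_of_isClosed isClosed_closure (isClosed_le continuous_const continuous_abs)
  have hKΩ : ∀ n, K n ⊆ Ω := by
    rintro n x ⟨hx, hx2⟩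
    by_contra hxΩ
    have hfr : x ∈ frontier Ω := by
      rw [hΩ.frontier_eq]; exact ⟨hx, hxΩ⟩
    have := h0 x hfr
    simp only [mem_preimage, mem_ofPred_eq, this, abs_zero] at hx2
    exact absurd hx2 (not_le.2 (inv_pos.2 (hNpos n)))
  have hψ0 : ∀ n, ∀ x ∉ K n, ψ n x = 0 := by
    intro n x hx
    by_cases hxΩ : x ∈ Ω
    · rw [hψin n x hxΩ, hS0, mul_zero]
      have : ¬ ((N n)⁻¹ ≤ |q x|) := fun h => hx ⟨subset_closure hxΩ, h⟩
      rw [abs_mul, abs_of_pos (hNpos n)]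
      rw [not_le] at this
      calc N n * |q x| ≤ N n * (N n)⁻¹ := mul_le_mul_of_nonneg_left this.le (hNpos n).le
        _ = 1 := mul_inv_cancel₀ (hNpos n).ne'
    · exact indicator_of_notMem hxΩ _
  have hts : ∀ n, tsupport (ψ n) ⊆ K n := fun n =>
    closure_minimal (fun x hx => by by_contra h; exact hx (hψ0 n x h)) (hKc n).isClosed
  have hb : ∀ n, ∀ x ∈ Ω, |ψ n x| ≤ |q x| := by
    intro n x hx
    rw [hψin n x hx, abs_mul, abs_of_pos (inv_pos.2 (hNpos n)), inv_mul_le_iff₀ (hNpos n)]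
    refine (hSb _).trans ?_
    rw [abs_mul, abs_of_pos (hNpos n)]
  have hlarge : ∀ x, q x ≠ 0 → ∀ᶠ n in atTop, 2 < |N n * q x| := by
    intro x hx
    have h1 : Tendsto (fun n => N n * |q x|) atTop atTop := by
      apply Tendsto.atTop_mul_const (abs_pos.2 hx)
      exact tendsto_atTop_add_const_right _ _ tendsto_natCast_atTop_atTop
    filter_upwards [h1.eventually_gt_atTop 2] with n hn
    rwa [abs_mul, abs_of_pos (hNpos n)]
  refine ⟨ψ, max R (C * R), le_max_left _ _, ?_, ?_, ?_, ?_⟩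
  · intro n
    refine ⟨?_, (hKc n).of_isClosed_subset (isClosed_tsupport _) (hts n), (hts n).trans (hKΩ n)⟩
    rw [contDiff_iff_contDiffAt]
    intro x
    by_cases hx : x ∈ Ω
    · refine ContDiffAt.congr_of_eventuallyEq ?_ (hψev n x hx)
      have h1 : ContDiffAt ℝ 1 q x := (hq x hx).of_le (by norm_num)
      have h2 : ContDiffAt ℝ 1 (fun x => N n * q x) x := contDiffAt_const.mul h1
      exact contDiffAt_const.mul (hS.contDiffAt.comp x h2)
    · have : x ∉ tsupport (ψ n) := fun h => hx (hKΩ n (hts n h))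
      exact contDiffAt_const.congr_of_eventuallyEq (notMem_tsupport_iff_eventuallyEq.1 this)
  · intro n x hx
    refine ⟨((hb n x hx).trans (hR x hx)).trans (le_max_left _ _), fun i => ?_⟩
    rw [hpd n x hx i, abs_mul]
    refine le_trans ?_ (le_max_right _ _)
    have := hR' x hx i
    have := hSd (N n * q x)
    gcongr
  · intro x hx
    by_cases h : q x = 0
    · have : ∀ n, ψ n x = q x := fun n => by
        have := hb n x hx
        rw [h, abs_zero] at this
        rw [h]; exact abs_nonpos_iff.1 this
      simp only [this]
      exact tendsto_const_nhds
    · refine tendsto_const_nhds.congr' ?_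
      filter_upwards [hlarge x h] with n hn
      rw [hψin n x hx, hS1 _ hn.le]
      have := (hNpos n).ne'
      field_simp
  · intro i
    filter_upwards [bu_grad_zero hΩ hqd i, ae_restrict_mem hΩ.measurableSet] with x hx0 hx
    by_cases h : q x = 0
    · simp only [hpd _ x hx, hx0 h, mul_zero]
      exact tendsto_const_nhds
    · refine tendsto_const_nhds.congr' ?_
      filter_upwards [hlarge x h] with n hn
      rw [hpd n x hx]
      have : S =ᶠ[𝓝 (N n * q x)] id := by
        have : ∀ᶠ s in 𝓝 (N n * q x), 2 < |s| := continuous_abs.continuousAt.eventually_const_lt hn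
        filter_upwards [this] with s hs using hS1 s hs.le
      rw [this.deriv_eq]
      simp

section hilb
variable {d : ℕ} {Ω : Set (Fin d → ℝ)} {T R : ℝ}

lemma bu_slice_meas (hΩ : IsOpen Ω) {f : (Fin d → ℝ) → ℝ} (hf : ContinuousOn f Ω) :
    AEStronglyMeasurable f (volume.restrict Ω) :=
  hf.aestronglyMeasurable hΩ.measurableSet

lemma bu_slice_bound (hΩ : IsOpen Ω) {f : (Fin d → ℝ) → ℝ} (hb : ∀ x ∈ Ω, |f x| ≤ R) :
    ∀ᵐ x ∂(volume.restrict Ω), |f x| ≤ R := by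
  filter_upwards [ae_restrict_mem hΩ.measurableSet] with x hx using hb x hx

lemma bu_slice_cont {v : (Fin d → ℝ) → ℝ → ℝ}
    (hv : ContinuousOn (fun q : (Fin d → ℝ) × ℝ => v q.1 q.2) (Ω ×ˢ Ioo 0 T)) {t : ℝ}
    (ht : t ∈ Ioo 0 T) : ContinuousOn (fun x => v x t) Ω :=
  hv.comp (f := fun x => (x, t)) (by fun_prop) fun _ hx => ⟨hx, ht⟩

lemma bu_finite (hΩb : Bornology.IsBounded Ω) : IsFiniteMeasure (volume.restrict Ω) :=
  ⟨by rw [Measure.restrict_apply_univ]; exact hΩb.measure_lt_top⟩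

lemma bu_memLp (hΩ : IsOpen Ω) (hΩb : Bornology.IsBounded Ω) {f : (Fin d → ℝ) → ℝ}
    (hf : ContinuousOn f Ω) (hb : ∀ x ∈ Ω, |f x| ≤ R) : MemLp f 2 (volume.restrict Ω) := by
  have := bu_finite hΩb
  exact MemLp.of_bound (bu_slice_meas hΩ hf) R (bu_slice_bound hΩ hb)

lemma bu_curve_cont (hΩ : IsOpen Ω) (hΩb : Bornology.IsBounded Ω) {v : (Fin d → ℝ) → ℝ → ℝ}
    (hv : ContinuousOn (fun q : (Fin d → ℝ) × ℝ => v q.1 q.2) (Ω ×ˢ Ioo 0 T))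
    (hb : ∀ x ∈ Ω, ∀ t ∈ Ioo 0 T, |v x t| ≤ R) :
    ContinuousOn (fun t => buH (volume.restrict Ω) (fun x => v x t)) (Ioo 0 T) := by
  have := bu_finite hΩb
  intro t ht
  apply buH_tendsto (R := R)
  · filter_upwards [self_mem_nhdsWithin] with s hs using bu_slice_meas hΩ (bu_slice_cont hv hs)
  · filter_upwards [self_mem_nhdsWithin] with s hs using bu_slice_bound hΩ fun x hx => hb x hx s hs
  · exact bu_slice_meas hΩ (bu_slice_cont hv ht)
  · exact bu_slice_bound hΩ fun x hx => hb x hx t ht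
  · filter_upwards [ae_restrict_mem hΩ.measurableSet] with x hx
    exact (hv.comp (f := fun t => (x, t)) (by fun_prop) fun s hs => ⟨hx, hs⟩) t ht

lemma bu_full_int (_hΩ : IsOpen Ω) {ψ v : (Fin d → ℝ) → ℝ} (h0 : ∀ x ∉ Ω, ψ x = 0) :
    ∫ x, v x * ψ x = ∫ x in Ω, v x * ψ x := by
  symm
  apply setIntegral_eq_integral_of_forall_compl_eq_zero
  intro x hx
  rw [h0 x hx, mul_zero]

lemma bu_inner_int {H : Type*} [NormedAddCommGroup H] [InnerProductSpace ℝ H] [CompleteSpace H]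
    {v : ℝ → H} {t1 t2 : ℝ} (h : IntervalIntegrable v volume t1 t2) (ξ : H) :
    inner ℝ (∫ r in t1..t2, v r) ξ = ∫ r in t1..t2, inner ℝ (v r) ξ := by
  have := (innerSL ℝ ξ).intervalIntegral_comp_comm h
  simp only [innerSL_apply_apply] at this
  rw [real_inner_comm, ← this]
  simp only [real_inner_comm]

/-- The gradient as an element of a Hilbert space. -/
noncomputable def buZ (μ : Measure (Fin d → ℝ)) (q : (Fin d → ℝ) → ℝ) :
    PiLp 2 (fun _ : Fin d => Lp ℝ 2 μ) := WithLp.toLp 2 (fun i => buH μ (pd i q))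

lemma BUSol.hilbert {w g : (Fin d → ℝ) → ℝ → ℝ}
    (h : BUSol Ω T w g) (hΩ : IsOpen Ω) (hΩb : Bornology.IsBounded Ω)
    (hg : ContinuousOn (fun q : (Fin d → ℝ) × ℝ => g q.1 q.2) (Ω ×ˢ Ioo 0 T))
    (hpd : ∀ i, ContinuousOn (fun q : (Fin d → ℝ) × ℝ => pd i (fun y => w y q.2) q.1) (Ω ×ˢ Ioo 0 T))
    (bw : ∀ x ∈ Ω, ∀ t ∈ Ioo 0 T, |w x t| ≤ R) (bg : ∀ x ∈ Ω, ∀ t ∈ Ioo 0 T, |g x t| ≤ R)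
    (bz : ∀ i, ∀ x ∈ Ω, ∀ t ∈ Ioo 0 T, |pd i (fun y => w y t) x| ≤ R)
    (hcl : ∀ t ∈ Ioo 0 T, ContinuousOn (fun x => w x t) (closure Ω))
    (h0 : ∀ t ∈ Ioo 0 T, ∀ x ∈ frontier Ω, w x t = 0) :
    ContinuousOn (fun t => buH (volume.restrict Ω) (fun x => w x t)) (Ioo 0 T) ∧
    ContinuousOn (fun t => buH (volume.restrict Ω) (fun x => g x t)) (Ioo 0 T) ∧
    ContinuousOn (fun t => buZ (volume.restrict Ω) (fun x => w x t)) (Ioo 0 T) ∧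
    ∀ s ∈ Ioo 0 T, ∀ t ∈ Ioo 0 T, ∀ t' ∈ Ioo 0 T, t ≤ t' →
      inner ℝ (buH (volume.restrict Ω) (fun x => w x t') - buH (volume.restrict Ω) (fun x => w x t))
        (buH (volume.restrict Ω) (fun x => w x s)) =
      - inner ℝ (∫ r in t..t', buZ (volume.restrict Ω) (fun x => w x r))
          (buZ (volume.restrict Ω) (fun x => w x s))
        + inner ℝ (∫ r in t..t', buH (volume.restrict Ω) (fun x => g x r))
          (buH (volume.restrict Ω) (fun x => w x s)) := by
  have := bu_finite hΩb
  set μ := volume.restrict Ω with hμ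
  have cw := bu_curve_cont hΩ hΩb h.cont bw
  have cg := bu_curve_cont hΩ hΩb hg bg
  have cz : ContinuousOn (fun t => buZ μ (fun x => w x t)) (Ioo 0 T) := by
    unfold buZ
    apply (PiLp.continuous_toLp 2 _).comp_continuousOn
    rw [continuousOn_pi]
    intro i
    exact bu_curve_cont (v := fun x t => pd i (fun y => w y t) x) hΩ hΩb (hpd i) (bz i)
  refine ⟨cw, cg, cz, ?_⟩
  intro s hs t ht t' ht' htt'
  obtain ⟨ψ, C, hRC, hψ1, hψ2, hψ3, hψ4⟩ := bu_test hΩ hΩb (hcl s hs) (h0 s hs) (h.c2 s hs)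
    (fun x hx => bw x hx s hs) (fun x hx i => bz i x hx s hs)
  have hsub : uIcc t t' ⊆ Ioo 0 T := by
    rw [uIcc_of_le htt']
    exact fun r hr => ⟨ht.1.trans_le hr.1, hr.2.trans_lt ht'.2⟩
  have ψc : ∀ n, ContinuousOn (ψ n) Ω := fun n => (hψ1 n).1.continuous.continuousOn
  have ψpc : ∀ n i, ContinuousOn (pd i (ψ n)) Ω := fun n i x _ =>
    (bu_pd_cont_of_c1 i (hψ1 n).1.contDiffAt).continuousWithinAt
  have mψ : ∀ n, MemLp (ψ n) 2 μ := fun n => bu_memLp hΩ hΩb (ψc n) fun x hx => (hψ2 n x hx).1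
  have mψp : ∀ n i, MemLp (pd i (ψ n)) 2 μ := fun n i =>
    bu_memLp hΩ hΩb (ψpc n i) fun x hx => (hψ2 n x hx).2 i
  have mw : ∀ r ∈ Ioo 0 T, MemLp (fun x => w x r) 2 μ := fun r hr =>
    bu_memLp hΩ hΩb (bu_slice_cont h.cont hr) fun x hx => bw x hx r hr
  have mg : ∀ r ∈ Ioo 0 T, MemLp (fun x => g x r) 2 μ := fun r hr =>
    bu_memLp hΩ hΩb (bu_slice_cont hg hr) fun x hx => bg x hx r hr
  have mz : ∀ i, ∀ r ∈ Ioo 0 T, MemLp (pd i (fun x => w x r)) 2 μ := fun i r hr =>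
    bu_memLp hΩ hΩb (bu_slice_cont (v := fun x t => pd i (fun y => w y t) x) (hpd i) hr)
      fun x hx => bz i x hx r hr
  have ψz : ∀ n, ∀ x ∉ Ω, ψ n x = 0 := fun n x hx =>
    image_eq_zero_of_notMem_tsupport fun hh => hx ((hψ1 n).2.2 hh)
  have ψpz : ∀ n i, ∀ x ∉ Ω, pd i (ψ n) x = 0 := fun n i x hx =>
    bu_pd_zero_off i fun hh => hx ((hψ1 n).2.2 hh)
  have iz : IntervalIntegrable (fun r => buZ μ (fun x => w x r)) volume t t' :=
    (cz.mono hsub).intervalIntegrable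
  have ig : IntervalIntegrable (fun r => buH μ (fun x => g x r)) volume t t' :=
    (cg.mono hsub).intervalIntegrable
  -- identity for the test functions
  have key : ∀ n, inner ℝ (buH μ (fun x => w x t') - buH μ (fun x => w x t)) (buH μ (ψ n)) =
      - inner ℝ (∫ r in t..t', buZ μ (fun x => w x r)) (buZ μ (ψ n))
        + inner ℝ (∫ r in t..t', buH μ (fun x => g x r)) (buH μ (ψ n)) := by
    intro n
    have := h.weak hΩ hg hpd (hψ1 n).1 (hψ1 n).2.1 (hψ1 n).2.2 ht ht' htt'
    rw [inner_sub_left, buH_inner (mw t' ht') (mψ n), buH_inner (mw t ht) (mψ n),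
      ← bu_full_int hΩ (ψz n), ← bu_full_int hΩ (ψz n), this, bu_inner_int iz, bu_inner_int ig,
      ← intervalIntegral.integral_neg, ← intervalIntegral.integral_add]
    · refine intervalIntegral.integral_congr fun r hr => ?_
      have hr' := hsub hr
      rw [buH_inner (mg r hr') (mψ n), ← bu_full_int hΩ (ψz n)]
      congr 2
      rw [PiLp.inner_apply]
      refine Finset.sum_congr rfl fun i _ => ?_
      simp only [buZ]
      rw [buH_inner (mz i r hr') (mψp n i), ← bu_full_int hΩ (ψpz n i)]
    · exact ((cz.mono hsub).inner continuousOn_const).neg.intervalIntegrable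
    · exact ((cg.mono hsub).inner continuousOn_const).intervalIntegrable
  have l1 : Tendsto (fun n => buH μ (ψ n)) atTop (𝓝 (buH μ (fun x => w x s))) := by
    apply buH_tendsto (R := C)
    · exact Eventually.of_forall fun n => bu_slice_meas hΩ (ψc n)
    · exact Eventually.of_forall fun n => bu_slice_bound hΩ fun x hx => (hψ2 n x hx).1
    · exact bu_slice_meas hΩ (bu_slice_cont h.cont hs)
    · exact bu_slice_bound hΩ fun x hx => (bw x hx s hs).trans hRC
    · filter_upwards [ae_restrict_mem hΩ.measurableSet] with x hx using hψ3 x hx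
  have l2 : Tendsto (fun n => buZ μ (ψ n)) atTop (𝓝 (buZ μ (fun x => w x s))) := by
    unfold buZ
    refine (PiLp.continuous_toLp 2 _).continuousAt.tendsto.comp ?_
    rw [tendsto_pi_nhds]
    intro i
    apply buH_tendsto (R := C)
    · exact Eventually.of_forall fun n => bu_slice_meas hΩ (ψpc n i)
    · exact Eventually.of_forall fun n => bu_slice_bound hΩ fun x hx => (hψ2 n x hx).2 i
    · exact bu_slice_meas hΩ (bu_slice_cont (v := fun x t => pd i (fun y => w y t) x) (hpd i) hs)
    · exact bu_slice_bound hΩ fun x hx => (bz i x hx s hs).trans hRC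
    · exact hψ4 i
  refine tendsto_nhds_unique (tendsto_const_nhds.inner l1) ?_
  simp only [key]
  exact (tendsto_const_nhds.inner l2).neg.add (tendsto_const_nhds.inner l1)
end hilb

lemma bu_local_lip {X Y : Type*} [NormedAddCommGroup X] [NormedSpace ℝ X] [NormedAddCommGroup Y]
    [NormedSpace ℝ Y] {C : Set X} {f : X × Y → ℝ} (hf : ContDiffOn ℝ 2 f (C ×ˢ univ))
    {x0 : X} {y0 : Y} (hx0 : x0 ∈ C) :
    ∃ r > 0, ∃ M : ℝ, ∀ x ∈ C, x ∈ Metric.ball x0 r → ∀ y ∈ Metric.ball y0 r, ∀ y' ∈ Metric.ball y0 r,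
      |f (x, y) - f (x, y')| ≤ M * ‖y - y'‖ := by
  have hp : (x0, y0) ∈ C ×ˢ (univ : Set Y) := ⟨hx0, mem_univ _⟩
  have h1 : ContDiffWithinAt ℝ (0 + 1) f (C ×ˢ univ) (x0, y0) := (hf _ hp).of_le (by norm_num)
  obtain ⟨u, hu, -, -, f', hf', hcf⟩ := (contDiffWithinAt_succ_iff_hasFDerivWithinAt' (by simp)).1 h1
  rw [insert_eq_of_mem hp] at hu
  set M := ‖f' (x0, y0)‖ + 1 with hM
  have hev : ∀ᶠ p in 𝓝[C ×ˢ univ] (x0, y0), ‖f' p‖ < M :=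
    hcf.continuousWithinAt.norm.eventually_lt_const (by rw [hM]; linarith)
  obtain ⟨r, hr, hball⟩ := Metric.mem_nhdsWithin_iff.1 (inter_mem hu hev)
  refine ⟨r, hr, M, ?_⟩
  intro x hxC hx y hy y' hy'
  have hin : ∀ v ∈ Metric.ball y0 r, (x, v) ∈ u ∩ {p | ‖f' p‖ < M} := fun v hv =>
    hball ⟨by rw [← ball_prod_same]; exact ⟨hx, hv⟩, ⟨hxC, mem_univ _⟩⟩
  have hd : ∀ v ∈ Metric.ball y0 r, HasFDerivWithinAt (fun v => f (x, v))
      ((f' (x, v)).comp (ContinuousLinearMap.inr ℝ X Y)) (Metric.ball y0 r) v := by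
    intro v hv
    have a1 := hf' _ (hin v hv).1
    have a2 : HasFDerivWithinAt (fun v : Y => (x, v)) (ContinuousLinearMap.inr ℝ X Y) (Metric.ball y0 r) v :=
      (hasFDerivAt_prodMk_right x v).hasFDerivWithinAt
    exact a1.comp v a2 fun v' _ => ⟨hxC, mem_univ _⟩
  have := (convex_ball y0 r).norm_image_sub_le_of_norm_hasFDerivWithin_le hd (C := M) (fun v hv => ?_) hy' hy
  · simpa using this
  · refine (ContinuousLinearMap.opNorm_comp_le _ _).trans ?_
    have b1 : ‖ContinuousLinearMap.inr ℝ X Y‖ ≤ 1 := by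
      apply ContinuousLinearMap.opNorm_le_bound _ zero_le_one
      intro v; simp
    have b2 : ‖f' (x, v)‖ < M := (hin v hv).2
    calc _ ≤ M * 1 := by gcongr
      _ = M := mul_one _

lemma bu_lip {X Y : Type*} [NormedAddCommGroup X] [NormedSpace ℝ X] [NormedAddCommGroup Y]
    [NormedSpace ℝ Y] [ProperSpace Y] {C : Set X} (hC : IsCompact C) {f : X × Y → ℝ}
    (hf : ContDiffOn ℝ 2 f (C ×ˢ univ)) (R : ℝ) :
    ∃ M : ℝ, ∀ x ∈ C, ∀ y ∈ Metric.closedBall (0:Y) R, ∀ y' ∈ Metric.closedBall (0:Y) R,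
      |f (x, y) - f (x, y')| ≤ M * ‖y - y'‖ := by
  set Q : Set (X × Y × Y) := C ×ˢ (Metric.closedBall (0:Y) R ×ˢ Metric.closedBall (0:Y) R) with hQ
  have hQc : IsCompact Q := hC.prod ((isCompact_closedBall _ _).prod (isCompact_closedBall _ _))
  have key := hQc.induction_on (p := fun s => ∃ M : ℝ, ∀ q ∈ s, |f (q.1, q.2.1) - f (q.1, q.2.2)|
      ≤ M * ‖q.2.1 - q.2.2‖) ⟨0, by simp⟩ (fun s t hst ⟨M, hM⟩ => ⟨M, fun q hq => hM q (hst hq)⟩)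
    (by
      rintro s t ⟨M, hM⟩ ⟨M', hM'⟩
      refine ⟨max M M', ?_⟩
      rintro q (hq | hq)
      · exact (hM q hq).trans (by gcongr; exact le_max_left _ _)
      · exact (hM' q hq).trans (by gcongr; exact le_max_right _ _))
    (by
      rintro ⟨x0, y0, y0'⟩ ⟨hx0, hy0, hy0'⟩
      simp only at hx0 hy0 hy0'
      by_cases hyy : y0 = y0'
      · subst hyy
        obtain ⟨r, hr, M, hM⟩ := bu_local_lip hf (y0 := y0) hx0
        refine ⟨Q ∩ (Metric.ball x0 r ×ˢ (Metric.ball y0 r ×ˢ Metric.ball y0 r)), ?_, M, ?_⟩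
        · refine inter_mem self_mem_nhdsWithin (mem_nhdsWithin_of_mem_nhds ?_)
          refine prod_mem_nhds (Metric.ball_mem_nhds _ hr) (prod_mem_nhds ?_ ?_) <;>
          exact Metric.ball_mem_nhds _ hr
        · rintro ⟨x, y, y'⟩ ⟨⟨h1, h2, h3⟩, ⟨h4, h5, h6⟩⟩
          exact hM x h1 h4 y h5 y' h6
      · have hfc := hf.continuousOn
        have c1 : ContinuousOn (fun q : X × Y × Y => f (q.1, q.2.1)) Q :=
          hfc.comp (f := fun q : X × Y × Y => (q.1, q.2.1)) (by fun_prop) fun q hq => ⟨hq.1, mem_univ _⟩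
        have c2 : ContinuousOn (fun q : X × Y × Y => f (q.1, q.2.2)) Q :=
          hfc.comp (f := fun q : X × Y × Y => (q.1, q.2.2)) (by fun_prop) fun q hq => ⟨hq.1, mem_univ _⟩
        have hmem : (x0, y0, y0') ∈ Q := ⟨hx0, hy0, hy0'⟩
        have hpos : 0 < ‖y0 - y0'‖ := norm_pos_iff.2 (sub_ne_zero.2 hyy)
        have c3 : ContinuousWithinAt (fun q : X × Y × Y => ‖q.2.1 - q.2.2‖) Q (x0, y0, y0') := by fun_prop
        have c4 := ((c1.sub c2).abs _ hmem).div c3 hpos.ne'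
        set V := |f (x0, y0) - f (x0, y0')| / ‖y0 - y0'‖ with hV
        have c5 : Tendsto (fun q : X × Y × Y => |f (q.1, q.2.1) - f (q.1, q.2.2)| / ‖q.2.1 - q.2.2‖)
          (𝓝[Q] (x0, y0, y0')) (𝓝 V) := c4
        have e1 := c5.eventually_lt_const (u := V + 1) (by linarith)
        have e2 := c3.eventually_const_lt (u := 0) hpos
        refine ⟨_, inter_mem e1 e2, V + 1, ?_⟩
        rintro ⟨x, y, y'⟩ ⟨h1, h2⟩
        have h1' : |f (x, y) - f (x, y')| / ‖y - y'‖ < V + 1 := h1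
        have h2' : 0 < ‖y - y'‖ := h2
        rw [div_lt_iff₀ h2'] at h1'
        exact h1'.le)
  obtain ⟨M, hM⟩ := key
  exact ⟨M, fun x hx y hy y' hy' => hM (x, y, y') ⟨hx, hy, hy'⟩⟩

section abstractCarleman
set_option linter.unusedSectionVars false
variable {H : Type*} [NormedAddCommGroup H] [InnerProductSpace ℝ H] [CompleteSpace H]

/-- Averages `∫_0^1 w (t + δ θ) dθ`. -/
noncomputable def buAvg {E : Type*} [NormedAddCommGroup E] [NormedSpace ℝ E]
    (w : ℝ → E) (δ t : ℝ) : E := ∫ θ in (0:ℝ)..1, w (t + δ * θ)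

lemma buAvg_cont {w : ℝ → H} (hw : Continuous w) :
    Continuous (fun q : ℝ × ℝ => buAvg w q.1 q.2) := by
  unfold buAvg
  apply intervalIntegral.continuous_parametric_intervalIntegral_of_continuous' (μ := volume)
    (f := fun (q : ℝ × ℝ) θ => w (q.2 + q.1 * θ))
  fun_prop

lemma buAvg_zero {w : ℝ → H} (t : ℝ) : buAvg w 0 t = w t := by
  simp [buAvg]

lemma buAvg_eq {w : ℝ → H} {δ : ℝ} (hδ : 0 < δ) (t : ℝ) :
    buAvg w δ t = δ⁻¹ • ∫ s in t..(t + δ), w s := by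
  unfold buAvg
  rw [intervalIntegral.integral_comp_add_mul _ hδ.ne']
  simp

lemma buAvg_deriv {w : ℝ → H} (hw : Continuous w) {δ : ℝ} (hδ : 0 < δ) (t : ℝ) :
    HasDerivAt (buAvg w δ) (δ⁻¹ • (w (t + δ) - w t)) t := by
  have h0 : buAvg w δ = fun t => δ⁻¹ • ((∫ s in (0:ℝ)..(t + δ), w s) - ∫ s in (0:ℝ)..t, w s) := by
    ext t
    rw [buAvg_eq hδ, intervalIntegral.integral_interval_sub_left
      (hw.intervalIntegrable _ _) (hw.intervalIntegrable _ _)]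
  rw [h0]
  have h1 : ∀ r, HasDerivAt (fun t => ∫ s in (0:ℝ)..t, w s) (w r) r := fun r =>
    intervalIntegral.integral_hasDerivAt_right (hw.intervalIntegrable _ _)
      (hw.stronglyMeasurableAtFilter _ _) hw.continuousAt
  have h2 := (h1 (t + δ)).comp_add_const t δ
  exact (h2.sub (h1 t)).const_smul δ⁻¹

lemma buAvg_inner {w : ℝ → H} (hw : Continuous w) (δ t : ℝ) (v : H) :
    inner ℝ v (buAvg w δ t) = ∫ θ in (0:ℝ)..1, inner ℝ v (w (t + δ * θ)) := by
  have := (innerSL ℝ v).intervalIntegral_comp_comm (a := 0) (b := 1) (μ := volume)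
    (f := fun θ => w (t + δ * θ)) (Continuous.intervalIntegrable (by fun_prop) _ _)
  simpa [buAvg] using this.symm

variable {K : Type*} [NormedAddCommGroup K] [InnerProductSpace ℝ K] [CompleteSpace K]

lemma bu_core_delta {w g : ℝ → H} {z : ℝ → K} (hw : Continuous w) (hg : Continuous g)
    (hz : Continuous z) {a b δ m σ : ℝ} (hab : a ≤ b) (hδ : 0 < δ) (hm : 0 < m) (ha : 0 ≤ a)
    (hσ : m ^ 2 / 4 + m + 1 ≤ m * σ)
    (hid : ∀ s ∈ Icc a (b + δ), ∀ t ∈ Icc a b,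
      inner ℝ (w (t + δ) - w t) (w s) = - inner ℝ (∫ r in t..(t + δ), z r) (z s)
        + inner ℝ (∫ r in t..(t + δ), g r) (w s)) :
    Real.exp (σ * Real.exp (2 * m * b) / m) *
        (‖buAvg z δ b‖ ^ 2 - σ * Real.exp (2 * m * b) * ‖buAvg w δ b‖ ^ 2)
      - Real.exp (σ * Real.exp (2 * m * a) / m) *
        (‖buAvg z δ a‖ ^ 2 - σ * Real.exp (2 * m * a) * ‖buAvg w δ a‖ ^ 2)
      ≤ ∫ t in a..b, Real.exp (σ * Real.exp (2 * m * t) / m) *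
        (‖buAvg g δ t‖ ^ 2 - m * ‖buAvg z δ t‖ ^ 2 - (m + 1) * ‖buAvg w δ t‖ ^ 2) := by
  set W := buAvg w δ with hW
  set Z := buAvg z δ with hZ
  set G := buAvg g δ with hG
  set W' : ℝ → H := fun t => δ⁻¹ • (w (t + δ) - w t) with hW'
  set Z' : ℝ → K := fun t => δ⁻¹ • (z (t + δ) - z t) with hZ'
  have hWd : ∀ t, HasDerivAt W (W' t) t := fun t => buAvg_deriv hw hδ t
  have hZd : ∀ t, HasDerivAt Z (Z' t) t := fun t => buAvg_deriv hz hδ t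
  have hWc : Continuous W := continuous_iff_continuousAt.2 fun t => (hWd t).continuousAt
  have hZc : Continuous Z := continuous_iff_continuousAt.2 fun t => (hZd t).continuousAt
  have hGc : Continuous G := continuous_iff_continuousAt.2 fun t => (buAvg_deriv hg hδ t).continuousAt
  have hW'c : Continuous W' := by fun_prop
  have hZ'c : Continuous Z' := by fun_prop
  have hN : ∀ t ∈ Icc a b, ∀ s ∈ Icc a (b + δ), inner ℝ (G t - W' t) (w s) = inner ℝ (Z t) (z s) := by
    intro t ht s hs
    have := hid s hs t ht
    rw [inner_sub_left, hG, hZ, buAvg_eq hδ, buAvg_eq hδ, hW']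
    simp only [real_inner_smul_left]
    rw [this]; ring
  have hN1 : ∀ t ∈ Icc a b, inner ℝ (G t - W' t) (W' t) = inner ℝ (Z t) (Z' t) := by
    intro t ht
    have h1 := hN t ht t ⟨ht.1, by linarith [ht.2]⟩
    have h2 := hN t ht (t + δ) ⟨by linarith [ht.1], by linarith [ht.2]⟩
    rw [show inner ℝ (G t - W' t) (W' t) = δ⁻¹ * (inner ℝ (G t - W' t) (w (t + δ))
      - inner ℝ (G t - W' t) (w t)) by rw [← inner_sub_right, ← real_inner_smul_right]]
    rw [h1, h2, ← inner_sub_right, ← real_inner_smul_right]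
  have hN2 : ∀ t ∈ Icc a b, inner ℝ (G t - W' t) (W t) = inner ℝ (Z t) (Z t) := by
    intro t ht
    conv_lhs => rw [hW, buAvg_inner hw]
    conv_rhs => enter [3]; rw [hZ]
    rw [buAvg_inner hz]
    refine intervalIntegral.integral_congr fun θ hθ => ?_
    rw [uIcc_of_le zero_le_one] at hθ
    refine hN t ht _ ⟨?_, ?_⟩
    · have := mul_nonneg hδ.le hθ.1; linarith [ht.1]
    · have := mul_le_mul_of_nonneg_left hθ.2 hδ.le; linarith [ht.2]
  set p : ℝ → ℝ := fun t => σ * Real.exp (2 * m * t) with hp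
  set ex : ℝ → ℝ := fun t => Real.exp (σ * Real.exp (2 * m * t) / m) with hex
  have hpd : ∀ t, HasDerivAt p (2 * m * p t) t := by
    intro t
    have h1 : HasDerivAt (fun t : ℝ => 2 * m * t) (2 * m) t := by
      simpa using (hasDerivAt_id t).const_mul (2 * m)
    exact (h1.exp.const_mul σ).congr_deriv (by simp only [hp]; ring)
  have hexd : ∀ t, HasDerivAt ex (2 * p t * ex t) t := by
    intro t
    exact ((hpd t).div_const m).exp.congr_deriv (by
      simp only [hp, hex]; field_simp)
  have hpc : Continuous p := by fun_prop
  have hexc : Continuous ex := by fun_prop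
  set J' : ℝ → ℝ := fun t => 2 * p t * ex t * (‖Z t‖ ^ 2 - p t * ‖W t‖ ^ 2) +
    ex t * (2 * inner ℝ (Z t) (Z' t) - (2 * m * p t * ‖W t‖ ^ 2 + p t * (2 * inner ℝ (W t) (W' t)))) with hJ'
  have hJd : ∀ t, HasDerivAt (fun t => ex t * (‖Z t‖ ^ 2 - p t * ‖W t‖ ^ 2)) (J' t) t := by
    intro t
    exact (hexd t).mul ((hZd t).norm_sq.sub ((hpd t).mul (hWd t).norm_sq))
  have hJc : Continuous J' := by fun_prop
  have hJint : ∫ t in a..b, J' t = ex b * (‖Z b‖ ^ 2 - p b * ‖W b‖ ^ 2) -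
      ex a * (‖Z a‖ ^ 2 - p a * ‖W a‖ ^ 2) :=
    intervalIntegral.integral_eq_sub_of_hasDerivAt (fun t _ => hJd t) (hJc.intervalIntegrable _ _)
  change ex b * (‖Z b‖ ^ 2 - p b * ‖W b‖ ^ 2) - ex a * (‖Z a‖ ^ 2 - p a * ‖W a‖ ^ 2) ≤ _
  rw [← hJint]
  apply intervalIntegral.integral_mono_on hab (hJc.intervalIntegrable _ _)
    (Continuous.intervalIntegrable (by fun_prop) _ _)
  intro t ht
  change J' t ≤ ex t * (‖G t‖ ^ 2 - m * ‖Z t‖ ^ 2 - (m + 1) * ‖W t‖ ^ 2)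
  have hex0 : 0 ≤ ex t := (Real.exp_pos _).le
  have e1 := hN1 t ht
  have e2 := hN2 t ht
  rw [real_inner_self_eq_norm_sq] at e2
  have hpt : m ^ 2 / 4 + m + 1 ≤ m * p t := by
    have h1 : 1 ≤ Real.exp (2 * m * t) := Real.one_le_exp (by have := ht.1; positivity [ha.trans ht.1])
    have : 0 ≤ m * σ := le_trans (by positivity) hσ
    calc _ ≤ m * σ * 1 := by linarith
      _ ≤ m * σ * Real.exp (2 * m * t) := by gcongr
      _ = _ := by simp only [hp]; ring
  have hJeq : J' t = ex t * (2 * p t * (‖Z t‖ ^ 2 - p t * ‖W t‖ ^ 2) +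
    (2 * inner ℝ (Z t) (Z' t) - (2 * m * p t * ‖W t‖ ^ 2 + p t * (2 * inner ℝ (W t) (W' t))))) := by
    simp only [hJ']; ring
  rw [hJeq]
  refine mul_le_mul_of_nonneg_left ?_ hex0
  -- pointwise inequality
  set N := G t - W' t with hNd
  have hGt : G t = (W' t + p t • W t) + (N - p t • W t) := by rw [hNd]; abel
  have q1 : ‖G t‖ ^ 2 = ‖W' t + p t • W t‖ ^ 2 + 2 * inner ℝ (W' t + p t • W t) (N - p t • W t)
      + ‖N - p t • W t‖ ^ 2 := by
    conv_lhs => rw [hGt]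
    rw [norm_add_sq_real]
  have q2 : inner ℝ (W' t + p t • W t) (N - p t • W t) = inner ℝ N (W' t) - p t * inner ℝ (W t) (W' t)
      + p t * inner ℝ N (W t) - p t ^ 2 * ‖W t‖ ^ 2 := by
    simp only [inner_add_left, inner_sub_right, real_inner_smul_left, real_inner_smul_right,
      real_inner_self_eq_norm_sq]
    rw [real_inner_comm N (W' t), real_inner_comm N (W t), real_inner_comm (W' t) (W t), norm_smul, mul_pow,
      Real.norm_eq_abs, sq_abs]
    ring
  have q3 : ‖(N - p t • W t) - (m / 2) • W t‖ ^ 2 = ‖N - p t • W t‖ ^ 2 -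
      m * (inner ℝ N (W t) - p t * ‖W t‖ ^ 2) + m ^ 2 / 4 * ‖W t‖ ^ 2 := by
    rw [norm_sub_sq_real, norm_smul, real_inner_smul_right, inner_sub_left, real_inner_smul_left,
      real_inner_self_eq_norm_sq, mul_pow, Real.norm_eq_abs, sq_abs]
    ring
  have q4 := sq_nonneg ‖W' t + p t • W t‖
  have q5 := sq_nonneg ‖(N - p t • W t) - (m / 2) • W t‖
  have q6 : (m ^ 2 / 4 + m + 1) * ‖W t‖ ^ 2 ≤ m * p t * ‖W t‖ ^ 2 := by gcongr
  rw [e1, e2] at q2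
  rw [e2] at q3
  rw [q2] at q1
  linarith


lemma bu_core {w g : ℝ → H} {z : ℝ → K} (hw : Continuous w) (hg : Continuous g)
    (hz : Continuous z) {a b b' m σ Z : ℝ} (hab : a ≤ b) (hb' : b < b') (hm : 0 < m) (ha : 0 ≤ a)
    (hσ : m ^ 2 / 4 + m + 1 ≤ m * σ)
    (hid : ∀ s ∈ Icc a b', ∀ t ∈ Icc a b', ∀ t' ∈ Icc a b', t ≤ t' →
      inner ℝ (w t' - w t) (w s) = - inner ℝ (∫ r in t..t', z r) (z s)
        + inner ℝ (∫ r in t..t', g r) (w s))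
    (hgm : ∀ t ∈ Icc a b, ‖g t‖ ^ 2 ≤ m * (‖w t‖ ^ 2 + ‖z t‖ ^ 2))
    (hZ : ‖z a‖ ≤ Z) :
    ∫ t in a..b, Real.exp (σ * Real.exp (2 * m * t) / m) * ‖w t‖ ^ 2 ≤
      Real.exp (σ * Real.exp (2 * m * a) / m) * Z ^ 2 +
      Real.exp (σ * Real.exp (2 * m * b) / m) * (σ * Real.exp (2 * m * b) * ‖w b‖ ^ 2) := by
  have hσ0 : 0 ≤ σ := by
    have : 0 < m * σ := lt_of_lt_of_le (by positivity) hσ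
    exact (pos_of_mul_pos_right this hm.le).le
  have cw := buAvg_cont hw
  have cz := buAvg_cont hz
  have cg := buAvg_cont hg
  have cw' : ∀ t, Continuous (fun δ => buAvg w δ t) := fun t =>
    cw.comp (continuous_id.prodMk continuous_const)
  have cz' : ∀ t, Continuous (fun δ => buAvg z δ t) := fun t =>
    cz.comp (continuous_id.prodMk continuous_const)
  have cL : Continuous (fun δ => Real.exp (σ * Real.exp (2 * m * b) / m) *
        (‖buAvg z δ b‖ ^ 2 - σ * Real.exp (2 * m * b) * ‖buAvg w δ b‖ ^ 2)
      - Real.exp (σ * Real.exp (2 * m * a) / m) *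
        (‖buAvg z δ a‖ ^ 2 - σ * Real.exp (2 * m * a) * ‖buAvg w δ a‖ ^ 2)) := by
    have := cw' a
    have := cw' b
    have := cz' a
    have := cz' b
    fun_prop
  have cR : Continuous (fun δ => ∫ t in a..b, Real.exp (σ * Real.exp (2 * m * t) / m) *
        (‖buAvg g δ t‖ ^ 2 - m * ‖buAvg z δ t‖ ^ 2 - (m + 1) * ‖buAvg w δ t‖ ^ 2)) := by
    apply intervalIntegral.continuous_parametric_intervalIntegral_of_continuous' (μ := volume)
      (f := fun (δ : ℝ) t => Real.exp (σ * Real.exp (2 * m * t) / m) *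
        (‖buAvg g δ t‖ ^ 2 - m * ‖buAvg z δ t‖ ^ 2 - (m + 1) * ‖buAvg w δ t‖ ^ 2))
    unfold Function.uncurry
    fun_prop
  have hlim := le_of_tendsto_of_tendsto (cL.continuousAt (x := 0)).continuousWithinAt.tendsto
    ((cR.continuousAt (x := 0)).continuousWithinAt (s := Ioi 0)).tendsto (by
      have : Ioo 0 (b' - b) ∈ 𝓝[>] (0:ℝ) := Ioo_mem_nhdsGT (by linarith)
      filter_upwards [this] with δ hδ
      refine bu_core_delta hw hg hz hab hδ.1 hm ha hσ ?_
      intro s hs t ht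
      have h2 := hδ.2
      have h1 := hδ.1
      exact hid s ⟨hs.1, by linarith [hs.2]⟩ t ⟨ht.1, by linarith [ht.2]⟩ (t + δ)
        ⟨by linarith [ht.1], by linarith [ht.2]⟩ (by linarith))
  simp only [buAvg_zero] at hlim
  have hmono : ∫ t in a..b, Real.exp (σ * Real.exp (2 * m * t) / m) *
        (‖g t‖ ^ 2 - m * ‖z t‖ ^ 2 - (m + 1) * ‖w t‖ ^ 2) ≤
      ∫ t in a..b, - (Real.exp (σ * Real.exp (2 * m * t) / m) * ‖w t‖ ^ 2) := by
    apply intervalIntegral.integral_mono_on hab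
      (Continuous.intervalIntegrable (by fun_prop) _ _)
      (Continuous.intervalIntegrable (by fun_prop) _ _)
    intro t ht
    have h1 := hgm t ht
    rw [← mul_neg]
    refine mul_le_mul_of_nonneg_left ?_ (Real.exp_pos _).le
    linarith
  rw [intervalIntegral.integral_neg] at hmono
  have e1 : Real.exp (σ * Real.exp (2 * m * a) / m) *
        (‖z a‖ ^ 2 - σ * Real.exp (2 * m * a) * ‖w a‖ ^ 2) ≤
      Real.exp (σ * Real.exp (2 * m * a) / m) * Z ^ 2 := by
    refine mul_le_mul_of_nonneg_left ?_ (Real.exp_pos _).le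
    have : ‖z a‖ ^ 2 ≤ Z ^ 2 := by gcongr
    have : 0 ≤ σ * Real.exp (2 * m * a) * ‖w a‖ ^ 2 := by positivity
    linarith
  have e2 : - (Real.exp (σ * Real.exp (2 * m * b) / m) * (σ * Real.exp (2 * m * b) * ‖w b‖ ^ 2)) ≤
      Real.exp (σ * Real.exp (2 * m * b) / m) *
        (‖z b‖ ^ 2 - σ * Real.exp (2 * m * b) * ‖w b‖ ^ 2) := by
    rw [← mul_neg]
    refine mul_le_mul_of_nonneg_left ?_ (Real.exp_pos _).le
    have := sq_nonneg ‖z b‖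
    linarith
  linarith

lemma bu_ext {E : Type*} [NormedAddCommGroup E] {v : ℝ → E} {a b' : ℝ} (hab' : a ≤ b')
    (h1 : ContinuousOn v (Icc a b')) : Continuous (fun t => v (projIcc a b' hab' t)) :=
  (continuousOn_iff_continuous_domRestrict.1 h1).comp continuous_projIcc

lemma bu_ext_int {E : Type*} [NormedAddCommGroup E] [NormedSpace ℝ E] (v : ℝ → E) {a b' t t' : ℝ}
    (hab' : a ≤ b') (ht : t ∈ Icc a b') (ht' : t' ∈ Icc a b') :
    ∫ r in t..t', v (projIcc a b' hab' r) = ∫ r in t..t', v r := by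
  refine intervalIntegral.integral_congr fun r hr => ?_
  rw [projIcc_of_mem hab' ((uIcc_subset_Icc ht ht') hr)]

/-- Abstract backward uniqueness. -/
lemma bu_abstract {w g : ℝ → H} {z : ℝ → K} {T m Z : ℝ} (hw : ContinuousOn w (Ioo 0 T))
    (hg : ContinuousOn g (Ioo 0 T)) (hz : ContinuousOn z (Ioo 0 T)) (hm : 0 < m)
    (hid : ∀ s ∈ Ioo 0 T, ∀ t ∈ Ioo 0 T, ∀ t' ∈ Ioo 0 T, t ≤ t' →
      inner ℝ (w t' - w t) (w s) = - inner ℝ (∫ r in t..t', z r) (z s)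
        + inner ℝ (∫ r in t..t', g r) (w s))
    (hgm : ∀ t ∈ Ioo 0 T, ‖g t‖ ^ 2 ≤ m * (‖w t‖ ^ 2 + ‖z t‖ ^ 2))
    (hZ : ∀ t ∈ Ioo 0 T, ‖z t‖ ≤ Z) (hend : Tendsto w (𝓝[<] T) (𝓝 0)) :
    ∀ t ∈ Ioo 0 T, w t = 0 := by
  -- the inequality for the original curves
  have key : ∀ σ, m ^ 2 / 4 + m + 1 ≤ m * σ → ∀ a b, 0 < a → a ≤ b → b < T →
      ∫ t in a..b, Real.exp (σ * Real.exp (2 * m * t) / m) * ‖w t‖ ^ 2 ≤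
      Real.exp (σ * Real.exp (2 * m * a) / m) * Z ^ 2 +
      Real.exp (σ * Real.exp (2 * m * b) / m) * (σ * Real.exp (2 * m * b) * ‖w b‖ ^ 2) := by
    intro σ hσ a b ha hab hb
    obtain ⟨b', hbb', hb'T⟩ := exists_between hb
    have hab' : a ≤ b' := by linarith
    have hsub : Icc a b' ⊆ Ioo 0 T := fun t ht => ⟨by linarith [ht.1], by linarith [ht.2]⟩
    have hsub' : Icc a b ⊆ Icc a b' := Icc_subset_Icc_right hbb'.le
    have pe : ∀ t ∈ Icc a b', ((projIcc a b' hab' t : Icc a b') : ℝ) = t := by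
      intro t ht
      rw [projIcc_of_mem hab' ht]
    have := bu_core (w := fun t => w (projIcc a b' hab' t)) (g := fun t => g (projIcc a b' hab' t))
      (z := fun t => z (projIcc a b' hab' t)) (bu_ext hab' (hw.mono hsub)) (bu_ext hab' (hg.mono hsub))
      (bu_ext hab' (hz.mono hsub)) (Z := Z) hab hbb' hm ha.le hσ
      (by
        intro s hs t ht t' ht' htt'
        rw [pe s hs, pe t ht, pe t' ht']
        have e1 := bu_ext_int z hab' ht ht'
        have e2 := bu_ext_int g hab' ht ht'
        rw [e1, e2]
        exact hid s (hsub hs) t (hsub ht) t' (hsub ht') htt')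
      (by
        intro t ht
        have ht' := hsub' ht
        rw [pe t ht']
        exact hgm t (hsub ht'))
      (by rw [pe a ⟨le_rfl, hab'⟩]; exact hZ a (hsub ⟨le_rfl, hab'⟩))
    rw [pe b ⟨hab, hbb'.le⟩] at this
    refine le_trans (le_of_eq ?_) this
    refine intervalIntegral.integral_congr fun r hr => ?_
    rw [uIcc_of_le hab] at hr
    rw [pe r (hsub' hr)]
  intro t0 ht0
  obtain ⟨e, hte, heT⟩ := exists_between ht0.2
  have ht00 := ht0.1
  set a := t0 / 2 with ha
  have ha0 : 0 < a := by positivity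
  have hat : a < t0 := by rw [ha]; linarith
  -- first limit b → T
  have k2 : ∀ σ, m ^ 2 / 4 + m + 1 ≤ m * σ →
      Real.exp (σ * Real.exp (2 * m * t0) / m) * ∫ t in t0..e, ‖w t‖ ^ 2 ≤
      Real.exp (σ * Real.exp (2 * m * a) / m) * Z ^ 2 := by
    intro σ hσ
    have hσ0 : 0 ≤ σ := by
      have : 0 < m * σ := lt_of_lt_of_le (by positivity) hσ
      exact (pos_of_mul_pos_right this hm.le).le
    have hl : Tendsto (fun b => Real.exp (σ * Real.exp (2 * m * a) / m) * Z ^ 2 +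
      Real.exp (σ * Real.exp (2 * m * b) / m) * (σ * Real.exp (2 * m * b) * ‖w b‖ ^ 2)) (𝓝[<] T)
      (𝓝 (Real.exp (σ * Real.exp (2 * m * a) / m) * Z ^ 2 +
      Real.exp (σ * Real.exp (2 * m * T) / m) * (σ * Real.exp (2 * m * T) * ‖(0:H)‖ ^ 2))) := by
      have c1 : Tendsto (fun b => Real.exp (σ * Real.exp (2 * m * b) / m)) (𝓝[<] T)
          (𝓝 (Real.exp (σ * Real.exp (2 * m * T) / m))) :=
        (Continuous.continuousAt (by fun_prop)).continuousWithinAt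
      have c2 : Tendsto (fun b => σ * Real.exp (2 * m * b)) (𝓝[<] T)
          (𝓝 (σ * Real.exp (2 * m * T))) :=
        (Continuous.continuousAt (by fun_prop)).continuousWithinAt
      exact (c1.mul (c2.mul (hend.norm.pow 2))).const_add _
    have : Real.exp (σ * Real.exp (2 * m * t0) / m) * ∫ t in t0..e, ‖w t‖ ^ 2 ≤
      (Real.exp (σ * Real.exp (2 * m * a) / m) * Z ^ 2 +
      Real.exp (σ * Real.exp (2 * m * T) / m) * (σ * Real.exp (2 * m * T) * ‖(0:H)‖ ^ 2)) := by
      refine ge_of_tendsto hl ?_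
      filter_upwards [Ioo_mem_nhdsLT heT] with b hb
      refine le_trans ?_ (key σ hσ a b ha0 (by linarith [hb.1]) hb.2)
      have hcont : ContinuousOn (fun t => Real.exp (σ * Real.exp (2 * m * t) / m) * ‖w t‖ ^ 2) (Ioo 0 T) :=
        (Continuous.continuousOn (by fun_prop)).mul (hw.norm.pow 2)
      have hsub : Icc a b ⊆ Ioo 0 T := fun t ht => ⟨by linarith [ht.1], by linarith [ht.2, hb.2]⟩
      rw [← intervalIntegral.integral_const_mul]
      calc ∫ t in t0..e, Real.exp (σ * Real.exp (2 * m * t0) / m) * ‖w t‖ ^ 2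
          ≤ ∫ t in t0..e, Real.exp (σ * Real.exp (2 * m * t) / m) * ‖w t‖ ^ 2 := by
            have hs : uIcc t0 e ⊆ Ioo 0 T := by
              rw [uIcc_of_le hte.le]
              exact fun t ht => ⟨by linarith [ht.1], by linarith [ht.2]⟩
            apply intervalIntegral.integral_mono_on hte.le
            · exact (continuousOn_const.mul ((hw.norm.pow 2).mono hs)).intervalIntegrable
            · exact (hcont.mono hs).intervalIntegrable
            · intro t ht
              have := ht.1
              gcongr
        _ ≤ _ := by
            apply intervalIntegral.integral_mono_interval hat.le hte.le hb.1.le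
            · exact Eventually.of_forall fun t => by positivity
            · apply ContinuousOn.intervalIntegrable
              rw [uIcc_of_le (by linarith [hb.1])]
              exact hcont.mono hsub
    simpa using this
  set κ := (Real.exp (2 * m * t0) - Real.exp (2 * m * a)) / m with hκ
  have hκ0 : 0 < κ := by
    apply div_pos _ hm
    rw [sub_pos]; gcongr
  have k3 : ∀ σ, m ^ 2 / 4 + m + 1 ≤ m * σ → ∫ t in t0..e, ‖w t‖ ^ 2 ≤ Real.exp (- (κ * σ)) * Z ^ 2 := by
    intro σ hσ
    have h1 := k2 σ hσ
    have e1 : Real.exp (-(κ * σ)) = Real.exp (σ * Real.exp (2 * m * a) / m) /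
        Real.exp (σ * Real.exp (2 * m * t0) / m) := by
      rw [← Real.exp_sub]; congr 1; rw [hκ]; field_simp; ring
    rw [e1, div_mul_eq_mul_div, le_div_iff₀ (Real.exp_pos _)]
    linarith
  have k4 : ∫ t in t0..e, ‖w t‖ ^ 2 ≤ 0 := by
    have hl : Tendsto (fun σ => Real.exp (- (κ * σ)) * Z ^ 2) atTop (𝓝 (0 * Z ^ 2)) := by
      refine Tendsto.mul_const _ ?_
      exact Real.tendsto_exp_neg_atTop_nhds_zero.comp (tendsto_id.const_mul_atTop hκ0)
    rw [zero_mul] at hl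
    refine ge_of_tendsto hl ?_
    filter_upwards [eventually_ge_atTop ((m ^ 2 / 4 + m + 1) / m)] with σ hσ
    apply k3
    rw [div_le_iff₀ hm] at hσ
    linarith
  by_contra hne
  have hs : Icc t0 e ⊆ Ioo 0 T := fun t ht => ⟨by linarith [ht.1], by linarith [ht.2]⟩
  have : 0 < ∫ t in t0..e, ‖w t‖ ^ 2 := by
    apply intervalIntegral.integral_pos hte ((hw.norm.pow 2).mono hs)
    · intro t _; exact sq_nonneg ‖w t‖
    · exact ⟨t0, ⟨le_rfl, hte.le⟩, pow_pos (norm_pos_iff.2 hne) 2⟩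
  linarith

end abstractCarleman

lemma bu_of_classical {d : ℕ} {Ω : Set (Fin d → ℝ)} (hΩ : IsOpen Ω) (hΩb : Bornology.IsBounded Ω)
    {f : ((Fin d → ℝ) × ℝ × (Fin d → ℝ)) → ℝ}
    (hf : ContDiffOn ℝ 2 f (closure Ω ×ˢ univ)) {T : ℝ} {u : (Fin d → ℝ) → ℝ → ℝ}
    (hu : IsClassicalSolOn Ω f T u) :
    BUSol Ω T u (fun x t => f (x, u x t, fun i => pd i (fun y => u y t) x)) ∧
    (∀ i, ContinuousOn (fun q : (Fin d → ℝ) × ℝ => pd i (fun y => u y q.2) q.1) (Ω ×ˢ Ioo 0 T)) ∧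
    ContinuousOn (fun q : (Fin d → ℝ) × ℝ => f (q.1, u q.1 q.2, fun i => pd i (fun y => u y q.2) q.1))
      (Ω ×ˢ Ioo 0 T) ∧
    ∃ R, 0 ≤ R ∧ ∀ x ∈ Ω, ∀ t ∈ Ioo 0 T, |u x t| ≤ R ∧ (∀ i, |pd i (fun y => u y t) x| ≤ R) ∧
      |f (x, u x t, fun i => pd i (fun y => u y t) x)| ≤ R := by
  obtain ⟨hc, hx2, ht1, h0, hpde, R, hR⟩ := hu
  have hsol : BUSol Ω T u (fun x t => f (x, u x t, fun i => pd i (fun y => u y t) x)) := by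
    refine ⟨hc.mono (prod_mono subset_closure Ioo_subset_Icc_self), ?_, ?_⟩
    · intro t ht x hx
      exact (hx2 t (Ioo_subset_Ioc_self ht)).contDiffAt (hΩ.mem_nhds hx)
    · intro x hx t ht
      have hn : Ioc 0 T ∈ 𝓝 t := Ioc_mem_nhds ht.1 ht.2
      have := ((ht1 x hx).contDiffAt hn).differentiableAt (by norm_num)
      have h2 := hpde x hx t (Ioo_subset_Ioc_self ht)
      rw [derivWithin_of_mem_nhds hn] at h2
      exact h2 ▸ this.hasDerivAt
  have hbd : ∀ x ∈ Ω, ∀ t ∈ Ioo 0 T, ((u x t, fun i => pd i (fun y => u y t) x) : ℝ × (Fin d → ℝ)) ∈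
      Metric.closedBall (0 : ℝ × (Fin d → ℝ)) (max R 0) := by
    intro x hx t ht
    obtain ⟨h1, h2⟩ := hR x hx t (Ioo_subset_Icc_self ht)
    rw [mem_closedBall_zero_iff, Prod.norm_def]
    refine max_le (h1.trans (le_max_left _ _)) ?_
    rw [pi_norm_le_iff_of_nonneg (le_max_right _ _)]
    exact fun i => (h2 i).trans (le_max_left _ _)
  obtain ⟨B, hB⟩ := ((hΩb.isCompact_closure).prod
    (isCompact_closedBall (0 : ℝ × (Fin d → ℝ)) (max R 0))).exists_bound_of_continuousOn
      (hf.continuousOn.mono (prod_mono subset_rfl (subset_univ _)))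
  have hgB : ∀ x ∈ Ω, ∀ t ∈ Ioo 0 T, |f (x, u x t, fun i => pd i (fun y => u y t) x)| ≤ max B 0 :=
    fun x hx t ht => (hB _ ⟨subset_closure hx, hbd x hx t ht⟩).trans (le_max_left _ _)
  have hpd := fun i => hsol.pd_cont hΩ (le_max_right B 0) hgB i
  refine ⟨hsol, hpd, ?_, max R 0 + max B 0, by positivity, ?_⟩
  · refine hf.continuousOn.comp (f := fun q : (Fin d → ℝ) × ℝ =>
      (q.1, u q.1 q.2, fun i => pd i (fun y => u y q.2) q.1)) ?_ fun q hq => ⟨subset_closure hq.1, mem_univ _⟩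
    exact continuousOn_fst.prodMk (hsol.cont.prodMk (continuousOn_pi.2 hpd))
  · intro x hx t ht
    obtain ⟨h1, h2⟩ := hR x hx t (Ioo_subset_Icc_self ht)
    have a1 := le_max_left R 0
    have a2 := le_max_right B 0
    have a3 := le_max_right R 0
    have a4 := hgB x hx t ht
    exact ⟨by linarith, fun i => by linarith [h2 i], by linarith⟩

theorem bu_main
    (d : ℕ)
    (Ω : Set (Fin d → ℝ)) (hΩo : IsOpen Ω)
    (hΩb : Bornology.IsBounded Ω)
    (f : ((Fin d → ℝ) × ℝ × (Fin d → ℝ)) → ℝ)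
    (hf : ContDiffOn ℝ 2 f
      (closure Ω ×ˢ ((univ : Set ℝ) ×ˢ (univ : Set (Fin d → ℝ)))))
    (T : ℝ) (hT : 0 < T)
    (u₁ u₂ : (Fin d → ℝ) → ℝ → ℝ)
    (hu₁ : IsClassicalSolOn Ω f T u₁) (hu₂ : IsClassicalSolOn Ω f T u₂)
    (hend : ∀ x ∈ Ω, u₁ x T = u₂ x T) :
    ∀ t ∈ Set.Icc (0:ℝ) T, ∀ x ∈ Ω, u₁ x t = u₂ x t := by
  rw [univ_prod_univ] at hf
  obtain ⟨s1, p1, c1, R1, hR1, b1⟩ := bu_of_classical hΩo hΩb hf hu₁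
  obtain ⟨s2, p2, c2, R2, hR2, b2⟩ := bu_of_classical hΩo hΩb hf hu₂
  set g1 : (Fin d → ℝ) → ℝ → ℝ := fun x t => f (x, u₁ x t, fun i => pd i (fun y => u₁ y t) x) with hg1
  set g2 : (Fin d → ℝ) → ℝ → ℝ := fun x t => f (x, u₂ x t, fun i => pd i (fun y => u₂ y t) x) with hg2
  set w : (Fin d → ℝ) → ℝ → ℝ := fun x t => u₁ x t - u₂ x t with hw
  set g : (Fin d → ℝ) → ℝ → ℝ := fun x t => g1 x t - g2 x t with hg
  have hs : BUSol Ω T w g := s1.sub s2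
  have hgc : ContinuousOn (fun q : (Fin d → ℝ) × ℝ => g q.1 q.2) (Ω ×ˢ Ioo 0 T) := c1.sub c2
  have hpdw : ∀ i, ∀ t ∈ Ioo 0 T, ∀ x ∈ Ω, pd i (fun y => w y t) x =
      pd i (fun y => u₁ y t) x - pd i (fun y => u₂ y t) x := fun i t ht x hx =>
    bu_pd_sub i ((s1.c2 t ht x hx).differentiableAt (by norm_num))
      ((s2.c2 t ht x hx).differentiableAt (by norm_num))
  set R := R1 + R2 with hR
  have hR0 : 0 ≤ R := by positivity
  have bw : ∀ x ∈ Ω, ∀ t ∈ Ioo 0 T, |w x t| ≤ R := fun x hx t ht =>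
    (abs_sub _ _).trans (add_le_add (b1 x hx t ht).1 (b2 x hx t ht).1)
  have bg : ∀ x ∈ Ω, ∀ t ∈ Ioo 0 T, |g x t| ≤ R := fun x hx t ht =>
    (abs_sub _ _).trans (add_le_add (b1 x hx t ht).2.2 (b2 x hx t ht).2.2)
  have bz : ∀ i, ∀ x ∈ Ω, ∀ t ∈ Ioo 0 T, |pd i (fun y => w y t) x| ≤ R := fun i x hx t ht => by
    rw [hpdw i t ht x hx]
    exact (abs_sub _ _).trans (add_le_add ((b1 x hx t ht).2.1 i) ((b2 x hx t ht).2.1 i))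
  have hpd := fun i => hs.pd_cont hΩo hR0 bg i
  have hwc : ContinuousOn (fun q : (Fin d → ℝ) × ℝ => w q.1 q.2) (closure Ω ×ˢ Icc 0 T) :=
    hu₁.1.sub hu₂.1
  have hcl : ∀ t ∈ Ioo 0 T, ContinuousOn (fun x => w x t) (closure Ω) := fun t ht =>
    hwc.comp (f := fun x => (x, t)) (by fun_prop) fun x hx => ⟨hx, Ioo_subset_Icc_self ht⟩
  have hwt : ∀ x ∈ Ω, ContinuousOn (w x) (Icc 0 T) := fun x hx =>
    hwc.comp (f := fun t => (x, t)) (by fun_prop) fun t ht => ⟨subset_closure hx, ht⟩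
  have h0 : ∀ t ∈ Ioo 0 T, ∀ x ∈ frontier Ω, w x t = 0 := fun t ht x hx => by
    simp only [hw]
    rw [hu₁.2.2.2.1 x hx t (Ioo_subset_Icc_self ht), hu₂.2.2.2.1 x hx t (Ioo_subset_Icc_self ht), sub_self]
  obtain ⟨kw, kg, kz, kid⟩ := hs.hilbert hΩo hΩb hgc hpd bw bg bz hcl h0
  have := bu_finite hΩb
  set μ := volume.restrict Ω with hμ
  have mw : ∀ r ∈ Ioo 0 T, MemLp (fun x => w x r) 2 μ := fun r hr =>
    bu_memLp hΩo hΩb (bu_slice_cont hs.cont hr) fun x hx => bw x hx r hr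
  have mg : ∀ r ∈ Ioo 0 T, MemLp (fun x => g x r) 2 μ := fun r hr =>
    bu_memLp hΩo hΩb (bu_slice_cont hgc hr) fun x hx => bg x hx r hr
  have mz : ∀ i, ∀ r ∈ Ioo 0 T, MemLp (pd i (fun x => w x r)) 2 μ := fun i r hr =>
    bu_memLp hΩo hΩb (bu_slice_cont (v := fun x t => pd i (fun y => w y t) x) (hpd i) hr)
      fun x hx => bz i x hx r hr
  have zn : ∀ t ∈ Ioo 0 T, ‖buZ μ (fun x => w x t)‖ ^ 2 = ∑ i, ∫ x, pd i (fun y => w y t) x ^ 2 ∂μ := by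
    intro t ht
    rw [PiLp.norm_sq_eq_of_L2]
    exact Finset.sum_congr rfl fun i _ => buH_norm (mz i t ht)
  -- Lipschitz bound
  obtain ⟨M, hM⟩ := bu_lip hΩb.isCompact_closure hf R
  have hgp : ∀ t ∈ Ioo 0 T, ∀ x ∈ Ω, g x t ^ 2 ≤ M ^ 2 * (w x t ^ 2 + ∑ i, pd i (fun y => w y t) x ^ 2) := by
    intro t ht x hx
    have hin : ∀ (v : ℝ × (Fin d → ℝ)), |v.1| ≤ R → (∀ i, |v.2 i| ≤ R) → v ∈ Metric.closedBall (0 : ℝ × (Fin d → ℝ)) R := by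
      intro v h1 h2
      rw [mem_closedBall_zero_iff, Prod.norm_def]
      exact max_le h1 ((pi_norm_le_iff_of_nonneg hR0).2 h2)
    have h1 := hM x (subset_closure hx) (u₁ x t, fun i => pd i (fun y => u₁ y t) x)
      (hin _ (by linarith [(b1 x hx t ht).1]) fun i => by linarith [(b1 x hx t ht).2.1 i])
      (u₂ x t, fun i => pd i (fun y => u₂ y t) x)
      (hin _ (by linarith [(b2 x hx t ht).1]) fun i => by linarith [(b2 x hx t ht).2.1 i])
    set S := w x t ^ 2 + ∑ i, pd i (fun y => w y t) x ^ 2 with hS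
    have hsum : 0 ≤ ∑ i, pd i (fun y => w y t) x ^ 2 := Finset.sum_nonneg fun i _ => sq_nonneg _
    have hS0 : 0 ≤ S := by positivity
    have h2 : ‖((u₁ x t, fun i => pd i (fun y => u₁ y t) x) : ℝ × (Fin d → ℝ)) -
      (u₂ x t, fun i => pd i (fun y => u₂ y t) x)‖ ≤ √S := by
      rw [Prod.mk_sub_mk, Prod.norm_def]
      refine max_le ?_ ?_
      · apply Real.abs_le_sqrt
        rw [hS]; change w x t ^ 2 ≤ _; linarith
      · rw [pi_norm_le_iff_of_nonneg (Real.sqrt_nonneg _)]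
        intro i
        apply Real.abs_le_sqrt
        change (pd i (fun y => u₁ y t) x - pd i (fun y => u₂ y t) x) ^ 2 ≤ S
        rw [← hpdw i t ht x hx, hS]
        have := Finset.single_le_sum (f := fun i => pd i (fun y => w y t) x ^ 2)
          (fun i _ => sq_nonneg _) (Finset.mem_univ i)
        have h3 := sq_nonneg (w x t)
        linarith
    have h3 : |g x t| ≤ |M| * √S := by
      refine h1.trans ?_
      calc _ ≤ |M| * _ := mul_le_mul_of_nonneg_right (le_abs_self M) (norm_nonneg _)
        _ ≤ _ := mul_le_mul_of_nonneg_left h2 (abs_nonneg M)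
    calc g x t ^ 2 = |g x t| ^ 2 := (sq_abs _).symm
      _ ≤ (|M| * √S) ^ 2 := by gcongr
      _ = M ^ 2 * S := by rw [mul_pow, sq_abs, Real.sq_sqrt hS0]
  have isq : ∀ {v : (Fin d → ℝ) → ℝ}, MemLp v 2 μ → Integrable (fun x => v x ^ 2) μ := fun hv => hv.integrable_sq
  have hgm : ∀ t ∈ Ioo 0 T, ‖buH μ (fun x => g x t)‖ ^ 2 ≤
      (M ^ 2 + 1) * (‖buH μ (fun x => w x t)‖ ^ 2 + ‖buZ μ (fun x => w x t)‖ ^ 2) := by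
    intro t ht
    have h1 : ‖buH μ (fun x => g x t)‖ ^ 2 ≤
      M ^ 2 * (‖buH μ (fun x => w x t)‖ ^ 2 + ‖buZ μ (fun x => w x t)‖ ^ 2) := by
      rw [buH_norm (mg t ht), buH_norm (mw t ht), zn t ht,
        ← integral_finsetSum _ fun i _ => isq (mz i t ht),
        ← integral_add (isq (mw t ht)) (integrable_finsetSum _ fun i _ => isq (mz i t ht)),
        ← integral_const_mul]
      apply integral_mono_ae (isq (mg t ht))
      · exact ((isq (mw t ht)).add (integrable_finsetSum _ fun i _ => isq (mz i t ht))).const_mul _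
      · filter_upwards [ae_restrict_mem hΩo.measurableSet] with x hx using hgp t ht x hx
    have h2 : 0 ≤ ‖buH μ (fun x => w x t)‖ ^ 2 + ‖buZ μ (fun x => w x t)‖ ^ 2 := by positivity
    linarith
  have hZ : ∀ t ∈ Ioo 0 T, ‖buZ μ (fun x => w x t)‖ ≤ √(∑ i : Fin d, ∫ x, R ^ 2 ∂μ) := by
    intro t ht
    refine (le_abs_self _).trans (Real.abs_le_sqrt ?_)
    rw [zn t ht]
    refine Finset.sum_le_sum fun i _ => ?_
    apply integral_mono_ae (isq (mz i t ht)) (integrable_const _)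
    filter_upwards [ae_restrict_mem hΩo.measurableSet] with x hx
    have := bz i x hx t ht
    change pd i (fun y => w y t) x ^ 2 ≤ R ^ 2
    rw [← sq_abs]
    gcongr
  have hendH : Tendsto (fun t => buH μ (fun x => w x t)) (𝓝[<] T) (𝓝 0) := by
    have z0 : buH μ (fun _ => (0:ℝ)) = 0 := by
      have : ‖buH μ (fun _ => (0:ℝ))‖ ^ 2 = 0 := by
        rw [buH_norm (by simp)]; simp
      simpa using this
    rw [← z0]
    have hmem : Ioo 0 T ∈ 𝓝[<] T := Ioo_mem_nhdsLT hT
    apply buH_tendsto (R := R)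
    · filter_upwards [hmem] with t ht using (mw t ht).1
    · filter_upwards [hmem] with t ht using bu_slice_bound hΩo fun x hx => bw x hx t ht
    · exact aestronglyMeasurable_const
    · exact Eventually.of_forall fun x => by simpa using hR0
    · filter_upwards [ae_restrict_mem hΩo.measurableSet] with x hx
      have h1 := hwt x hx T ⟨hT.le, le_rfl⟩
      have h2 : w x T = 0 := by simp only [hw]; rw [hend x hx, sub_self]
      have h3 := h1.tendsto
      rw [h2] at h3
      refine h3.mono_left ?_
      rw [nhdsWithin_le_iff]
      filter_upwards [hmem] with t ht using Ioo_subset_Icc_self ht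
  have hzero := bu_abstract kw kg kz (by positivity) kid hgm hZ hendH
  have hz2 : ∀ t ∈ Ioo 0 T, ∀ x ∈ Ω, w x t = 0 := by
    intro t ht
    have h1 : (fun x => w x t) =ᵐ[μ] fun _ => 0 := by
      have a1 := buH_coe (mw t ht)
      have a2 : buH μ (fun x => w x t) = 0 := hzero t ht
      rw [a2] at a1
      exact a1.symm.trans (Lp.coeFn_zero _ _ _)
    exact Measure.eqOn_open_of_ae_eq h1 hΩo (bu_slice_cont hs.cont ht) continuousOn_const
  intro t ht x hx
  have h1 : EqOn (w x) (fun _ => 0) (Icc 0 T) := by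
    refine EqOn.of_subset_closure (s := Ioo 0 T) (fun t ht => hz2 t ht x hx) (hwt x hx) continuousOn_const
      Ioo_subset_Icc_self ?_
    rw [closure_Ioo hT.ne]
  exact sub_eq_zero.1 (h1 ht)

end BUHelpers

/-- Corollary `coro-backward-unique-S`: backward uniqueness for the
nonlinear parabolic equation. -/
theorem backward_uniqueness_nonlinear
    (d : ℕ) (γ : NNReal) (hγ0 : 0 < γ) (hγ1 : γ ≤ 1)
    (Ω : Set (Fin d → ℝ)) (hΩo : IsOpen Ω) (hΩc : IsConnected Ω)
    (hΩb : Bornology.IsBounded Ω) (hΩreg : HasC2HolderBoundary Ω γ)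
    (f : ((Fin d → ℝ) × ℝ × (Fin d → ℝ)) → ℝ)
    (hf : ContDiffOn ℝ 2 f
      (closure Ω ×ˢ ((univ : Set ℝ) ×ˢ (univ : Set (Fin d → ℝ)))))
    (T : ℝ) (hT : 0 < T)
    (u₁ u₂ : (Fin d → ℝ) → ℝ → ℝ)
    (hu₁ : IsClassicalSolOn Ω f T u₁) (hu₂ : IsClassicalSolOn Ω f T u₂)
    (hend : ∀ x ∈ Ω, u₁ x T = u₂ x T) :
    ∀ t ∈ Set.Icc (0:ℝ) T, ∀ x ∈ Ω, u₁ x t = u₂ x t := by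
  exact bu_main d Ω hΩo hΩb f hf T hT u₁ u₂ hu₁ hu₂ hend
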